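/- arXiv:2507.13711 — 2 statements merged into one kernel-verified Lean document; each statement's English description precedes it below -/
import Mathlib

section
/- Let n = 1 and s ∈ (0,1). For every k ∈ ℕ there exist a function f_k ∈ C^k([0, 1/2]) and a function u_k ∈ L^∞(ℝ) ∩ C⁰(ℝ) ∩ C^∞((0,1)) satisfying −u_k'' + (−Δ)^s u_k = f_k in (0, 1/2) and u_k = 0 on (−∞, 0], such that: if s ∈ (0, 1/2), then u_k ∈ C^{2,1−2s}([0,1/2]) but u_k ∉ C^{2,1−2s+ε}([0,1/2]) for every ε > 0; if s = 1/2, then u_k ∈ C^{1,1−ε}([0,1/2]) for every ε ∈ (0,1) but u_k ∉ C^{1,1}([0,1/2]); if s ∈ (1/2, 1), then u_k ∈ C^{1,2−2s}([0,1/2]) but u_k ∉ C^{1,2−2s+ε}([0,1/2]) for every ε > 0. -/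
open Filter MeasureTheory Set
open scoped Topology

noncomputable section

/-- The normalizing constant of the one-dimensional fractional Laplacian. -/
def fracConst (s : ℝ) : ℝ :=
  2 ^ (2 * s) * Real.Gamma ((1 + 2 * s) / 2) * s * (1 - s) /
    (Real.sqrt Real.pi * Real.Gamma (2 - s))

/-- Truncated integrals whose limit defines the principal value in `(-Δ)^s u (x)`. -/
def fracTrunc (s : ℝ) (u : ℝ → ℝ) (x ε : ℝ) : ℝ :=
  ∫ y in {y : ℝ | ε ≤ |x - y|}, (u x - u y) / |x - y| ^ (1 + 2 * s)

/-- `(-Δ)^s u (x) = L`, in the principal value sense. -/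
def HasFracLap (s : ℝ) (u : ℝ → ℝ) (x L : ℝ) : Prop :=
  ∃ I : ℝ, Tendsto (fracTrunc s u x) (𝓝[>] (0 : ℝ)) (𝓝 I) ∧ L = fracConst s * I

/-- `u ∈ C^{m,β}([0, 1/2])`: `m` times continuously differentiable on `[0,1/2]` with
uniformly `β`-Hölder continuous `m`-th derivative. -/
def HolderIcc (m : ℕ) (β : ℝ) (u : ℝ → ℝ) : Prop :=
  ContDiffOn ℝ m u (Icc (0 : ℝ) (1 / 2)) ∧
    ∃ C : ℝ, ∀ x ∈ Icc (0 : ℝ) (1 / 2), ∀ y ∈ Icc (0 : ℝ) (1 / 2),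
      |iteratedDerivWithin m u (Icc (0 : ℝ) (1 / 2)) x -
          iteratedDerivWithin m u (Icc (0 : ℝ) (1 / 2)) y| ≤ C * |x - y| ^ β

/-- The auxiliary functions `u_{α,j}`: `u_{α,0} = x^α` on `(0,1)`, `0` for `x ≤ 0`, `1`
for `x ≥ 1`; and `u_{α,j} = x^α log^j x` on `(0,1)`, `0` otherwise, for `j ≥ 1`. -/
def uaj (α : ℝ) (j : ℕ) (x : ℝ) : ℝ :=
  if 0 < x ∧ x < 1 then x ^ α * Real.log x ^ j
  else if j = 0 ∧ 1 ≤ x then 1 else 0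

end

noncomputable section BClass

/-- The Euler operator. -/
def theta (u : ℝ → ℝ) : ℝ → ℝ := fun x => x * deriv u x

/-- Finite-order conormal classes. -/
def Bm : ℕ → ℝ → (ℝ → ℝ) → Prop
  | 0, γ, u => ∃ C : ℝ, ∀ x ∈ Ioc (0 : ℝ) 1, |u x| ≤ C * x ^ γ
  | m + 1, γ, u => (∃ C : ℝ, ∀ x ∈ Ioc (0 : ℝ) 1, |u x| ≤ C * x ^ γ) ∧
      DifferentiableOn ℝ u (Ioi 0) ∧ Bm m γ (theta u)

/-- Conormal class. -/
def BB (γ : ℝ) (u : ℝ → ℝ) : Prop := ∀ m, Bm m γ u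

theorem Bm.bound' {m γ u} (h : Bm m γ u) : ∃ C : ℝ, ∀ x ∈ Ioc (0 : ℝ) 1, |u x| ≤ C * x ^ γ := by
  cases m with
  | zero => exact h
  | succ m => exact h.1

theorem Bm.bound {m γ u} (h : Bm m γ u) :
    ∃ C : ℝ, 0 ≤ C ∧ ∀ x ∈ Ioc (0 : ℝ) 1, |u x| ≤ C * x ^ γ := by
  obtain ⟨C, hC⟩ := h.bound'
  refine ⟨C, ?_, hC⟩
  have := hC 1 (by simp)
  simp at this
  exact (abs_nonneg _).trans this

theorem diffAt_of {u : ℝ → ℝ} (h : DifferentiableOn ℝ u (Ioi 0)) {x : ℝ} (hx : 0 < x) :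
    DifferentiableAt ℝ u x := (h x hx).differentiableAt (Ioi_mem_nhds hx)

theorem deriv_congr_Ioi {u v : ℝ → ℝ} (h : EqOn u v (Ioi 0)) {x : ℝ} (hx : 0 < x) :
    deriv u x = deriv v x := by
  apply Filter.EventuallyEq.deriv_eq
  filter_upwards [Ioi_mem_nhds hx] with y hy using h hy

theorem theta_congr {u v : ℝ → ℝ} (h : EqOn u v (Ioi 0)) : EqOn (theta u) (theta v) (Ioi 0) := by
  intro x hx
  simp only [theta, deriv_congr_Ioi h hx]

theorem Bm.congr {m γ} {u v : ℝ → ℝ} (h : EqOn u v (Ioi 0)) (hu : Bm m γ u) : Bm m γ v := by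
  induction m generalizing u v with
  | zero =>
    obtain ⟨C, hC⟩ := hu
    exact ⟨C, fun x hx => by rw [← h hx.1]; exact hC x hx⟩
  | succ m ih =>
    obtain ⟨⟨C, hC⟩, h2, h3⟩ := hu
    exact ⟨⟨C, fun x hx => by rw [← h hx.1]; exact hC x hx⟩, h2.congr (fun x hx => (h hx).symm),
      ih (theta_congr h) h3⟩

theorem BB.congr {γ} {u v : ℝ → ℝ} (h : EqOn u v (Ioi 0)) (hu : BB γ u) : BB γ v :=
  fun m => (hu m).congr h

theorem Bm.pred {m γ u} (h : Bm (m + 1) γ u) : Bm m γ u := by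
  induction m generalizing u with
  | zero => exact h.1
  | succ m ih => exact ⟨h.1, h.2.1, ih h.2.2⟩

theorem bound_mono {γ γ' : ℝ} {u : ℝ → ℝ} (hg : γ' ≤ γ)
    (h : ∃ C : ℝ, 0 ≤ C ∧ ∀ x ∈ Ioc (0 : ℝ) 1, |u x| ≤ C * x ^ γ) :
    ∃ C : ℝ, ∀ x ∈ Ioc (0 : ℝ) 1, |u x| ≤ C * x ^ γ' := by
  obtain ⟨C, h0, hC⟩ := h
  refine ⟨C, fun x hx => (hC x hx).trans ?_⟩
  exact mul_le_mul_of_nonneg_left (Real.rpow_le_rpow_of_exponent_ge hx.1 hx.2 hg) h0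

theorem Bm.mono {m} {γ γ' : ℝ} {u : ℝ → ℝ} (hg : γ' ≤ γ) (h : Bm m γ u) : Bm m γ' u := by
  induction m generalizing u with
  | zero => exact bound_mono hg h.bound
  | succ m ih => exact ⟨bound_mono hg h.bound, h.2.1, ih h.2.2⟩

theorem BB.mono {γ γ' : ℝ} {u : ℝ → ℝ} (hg : γ' ≤ γ) (h : BB γ u) : BB γ' u :=
  fun m => (h m).mono hg

theorem bound_add {γ : ℝ} {u v : ℝ → ℝ}
    (hu : ∃ C : ℝ, 0 ≤ C ∧ ∀ x ∈ Ioc (0 : ℝ) 1, |u x| ≤ C * x ^ γ)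
    (hv : ∃ C : ℝ, 0 ≤ C ∧ ∀ x ∈ Ioc (0 : ℝ) 1, |v x| ≤ C * x ^ γ) :
    ∃ C : ℝ, ∀ x ∈ Ioc (0 : ℝ) 1, |u x + v x| ≤ C * x ^ γ := by
  obtain ⟨C, h0, hC⟩ := hu
  obtain ⟨D, h1, hD⟩ := hv
  refine ⟨C + D, fun x hx => (abs_add_le _ _).trans ?_⟩
  rw [add_mul]
  exact add_le_add (hC x hx) (hD x hx)

theorem bound_mul {γ δ : ℝ} {u v : ℝ → ℝ}
    (hu : ∃ C : ℝ, 0 ≤ C ∧ ∀ x ∈ Ioc (0 : ℝ) 1, |u x| ≤ C * x ^ γ)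
    (hv : ∃ C : ℝ, 0 ≤ C ∧ ∀ x ∈ Ioc (0 : ℝ) 1, |v x| ≤ C * x ^ δ) :
    ∃ C : ℝ, ∀ x ∈ Ioc (0 : ℝ) 1, |u x * v x| ≤ C * x ^ (γ + δ) := by
  obtain ⟨C, h0, hC⟩ := hu
  obtain ⟨D, h1, hD⟩ := hv
  refine ⟨C * D, fun x hx => ?_⟩
  rw [abs_mul, Real.rpow_add hx.1]
  calc |u x| * |v x| ≤ (C * x ^ γ) * (D * x ^ δ) :=
        mul_le_mul (hC x hx) (hD x hx) (abs_nonneg _) ((abs_nonneg _).trans (hC x hx))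
    _ = _ := by ring

theorem Bm.add {m} {γ : ℝ} {u v : ℝ → ℝ} (hu : Bm m γ u) (hv : Bm m γ v) :
    Bm m γ (fun x => u x + v x) := by
  induction m generalizing u v with
  | zero => exact bound_add hu.bound hv.bound
  | succ m ih =>
    refine ⟨bound_add hu.bound hv.bound, hu.2.1.add hv.2.1, (ih hu.2.2 hv.2.2).congr ?_⟩
    intro x hx
    have : deriv (fun x => u x + v x) x = deriv u x + deriv v x :=
      deriv_fun_add (diffAt_of hu.2.1 hx) (diffAt_of hv.2.1 hx)
    simp only [theta, this]; ring

theorem BB.add {γ : ℝ} {u v : ℝ → ℝ} (hu : BB γ u) (hv : BB γ v) :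
    BB γ (fun x => u x + v x) := fun m => (hu m).add (hv m)

theorem Bm.mul {m} {γ δ : ℝ} {u v : ℝ → ℝ} (hu : Bm m γ u) (hv : Bm m δ v) :
    Bm m (γ + δ) (fun x => u x * v x) := by
  induction m generalizing u v with
  | zero => exact bound_mul hu.bound hv.bound
  | succ m ih =>
    refine ⟨bound_mul hu.bound hv.bound, hu.2.1.mul hv.2.1,
      ((ih hu.2.2 hv.pred).add (ih hu.pred hv.2.2)).congr ?_⟩
    intro x hx
    have : deriv (fun x => u x * v x) x = deriv u x * v x + u x * deriv v x :=
      deriv_fun_mul (diffAt_of hu.2.1 hx) (diffAt_of hv.2.1 hx)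
    simp only [theta, this]; ring

theorem BB.mul {γ δ : ℝ} {u v : ℝ → ℝ} (hu : BB γ u) (hv : BB δ v) :
    BB (γ + δ) (fun x => u x * v x) := fun m => (hu m).mul (hv m)

theorem BB.theta {γ u} (h : BB γ u) : BB γ (theta u) := fun m => (h (m + 1)).2.2

theorem BB.diff {γ u} (h : BB γ u) : DifferentiableOn ℝ u (Ioi 0) := (h 1).2.1

theorem BB.bound {γ u} (h : BB γ u) :
    ∃ C : ℝ, 0 ≤ C ∧ ∀ x ∈ Ioc (0 : ℝ) 1, |u x| ≤ C * x ^ γ := (h 0).bound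

theorem BB.of_theta {γ u} (hb : ∃ C : ℝ, ∀ x ∈ Ioc (0 : ℝ) 1, |u x| ≤ C * x ^ γ)
    (hd : DifferentiableOn ℝ u (Ioi 0)) (h : BB γ (_root_.theta u)) : BB γ u := by
  intro m
  cases m with
  | zero => exact hb
  | succ m => exact ⟨hb, hd, h m⟩

theorem BB.smooth {u : ℝ → ℝ} (h : ContDiff ℝ (⊤ : ℕ∞) u) : BB 0 u := by
  intro m
  have key : ∀ u : ℝ → ℝ, ContDiff ℝ (⊤ : ℕ∞) u →
      ∃ C : ℝ, ∀ x ∈ Ioc (0 : ℝ) 1, |u x| ≤ C * x ^ (0 : ℝ) := by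
    intro u hu
    obtain ⟨C, hC⟩ := (isCompact_Icc (a := (0 : ℝ)) (b := 1)).exists_bound_of_continuousOn
      hu.continuous.continuousOn
    exact ⟨C, fun x hx => by simpa using hC x ⟨hx.1.le, hx.2⟩⟩
  induction m generalizing u with
  | zero => exact key u h
  | succ m ih =>
    refine ⟨key u h, (h.differentiable (by simp)).differentiableOn, ih ?_⟩
    have h2 : ContDiff ℝ (⊤ : ℕ∞) (deriv u) := (contDiff_infty_iff_deriv.1 h).2
    exact contDiff_id.mul h2

theorem BB.const_mul {γ : ℝ} {u : ℝ → ℝ} (c : ℝ) (hu : BB γ u) : BB γ (fun x => c * u x) := by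
  have := (BB.smooth (u := fun _ => c) contDiff_const).mul hu
  rwa [zero_add] at this

theorem BB.rpow (α : ℝ) : BB α (fun x => x ^ α) := by
  have hb : ∃ C : ℝ, ∀ x ∈ Ioc (0 : ℝ) 1, |x ^ α| ≤ C * x ^ α :=
    ⟨1, fun x hx => by rw [one_mul, abs_of_nonneg (Real.rpow_nonneg hx.1.le _)]⟩
  intro m
  induction m with
  | zero => exact hb
  | succ m ih =>
    refine ⟨hb, fun x hx => (Real.hasDerivAt_rpow_const
      (Or.inl (ne_of_gt hx))).differentiableAt.differentiableWithinAt, ?_⟩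
    have h0 : Bm m 0 (fun _ => α) := BB.smooth contDiff_const m
    have := h0.mul ih
    rw [zero_add] at this
    refine this.congr fun x hx => ?_
    simp only [_root_.theta]
    rw [(Real.hasDerivAt_rpow_const (Or.inl (ne_of_gt hx))).deriv, Real.rpow_sub_one (ne_of_gt hx)]
    have : x ≠ 0 := ne_of_gt hx
    field_simp

theorem BB.log {ε : ℝ} (hε : 0 < ε) : BB (-ε) Real.log := by
  refine BB.of_theta ?_ ?_ ?_
  · refine ⟨1 / ε, fun x hx => ?_⟩
    rw [abs_of_nonpos (Real.log_nonpos hx.1.le hx.2), ← Real.log_inv]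
    have := Real.log_le_rpow_div (inv_nonneg.2 hx.1.le) hε
    rw [Real.inv_rpow hx.1.le, ← Real.rpow_neg hx.1.le] at this
    rw [div_mul_eq_mul_div, one_mul]
    exact this
  · exact fun x hx => (Real.hasDerivAt_log (ne_of_gt hx)).differentiableAt.differentiableWithinAt
  · have h1 : BB 0 (fun _ : ℝ => (1 : ℝ)) := BB.smooth contDiff_const
    refine (h1.mono (by linarith)).congr fun x hx => ?_
    have : x ≠ 0 := ne_of_gt hx
    simp [_root_.theta, this]

theorem BB.contDiffOn {γ u} (h : BB γ u) : ContDiffOn ℝ (⊤ : ℕ∞) u (Ioi 0) := by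
  rw [contDiffOn_infty]
  intro n
  induction n generalizing u with
  | zero => exact contDiffOn_zero.2 h.diff.continuousOn
  | succ n ih =>
    push_cast
    rw [contDiffOn_succ_iff_deriv_of_isOpen isOpen_Ioi]
    refine ⟨h.diff, by simp, ?_⟩
    have h1 : ContDiffOn ℝ n (fun x => x⁻¹ * _root_.theta u x) (Ioi 0) :=
      (contDiffOn_inv ℝ |>.mono fun x hx => ne_of_gt hx).mul (ih h.theta)
    refine h1.congr fun x hx => ?_
    have : x ≠ 0 := ne_of_gt hx
    simp only [_root_.theta]; field_simp

theorem BB.deriv {γ u} (h : BB γ u) : BB (γ - 1) (deriv u) := by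
  have := (BB.rpow (-1)).mul h.theta
  rw [show -1 + γ = γ - 1 by ring] at this
  refine this.congr fun x hx => ?_
  have hx' : x ≠ 0 := ne_of_gt hx
  simp only [_root_.theta]
  rw [Real.rpow_neg_one]; field_simp

theorem BB.continuousOn {γ u} (h : BB γ u) : ContinuousOn u (Ioi 0) := h.diff.continuousOn

theorem BB.intervalIntegrable {β : ℝ} {g : ℝ → ℝ} (h : BB β g) (hβ : -1 < β) {x : ℝ} (hx : 0 < x) :
    IntervalIntegrable g volume 0 x := by
  have h1 : IntervalIntegrable g volume 0 1 := by
    obtain ⟨C, h0, hC⟩ := h.bound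
    have hi : IntervalIntegrable (fun x : ℝ => C * x ^ β) volume 0 1 :=
      (intervalIntegral.intervalIntegrable_rpow' hβ).const_mul C
    rw [intervalIntegrable_iff_integrableOn_Ioc_of_le zero_le_one] at hi ⊢
    refine Integrable.mono' hi ?_ ?_
    · exact (h.continuousOn.mono fun x hx => hx.1).aestronglyMeasurable measurableSet_Ioc
    · filter_upwards [ae_restrict_mem measurableSet_Ioc] with y hy using hC y hy
  refine h1.trans ?_
  refine ContinuousOn.intervalIntegrable (h.continuousOn.mono fun y hy => ?_)
  rcases le_total 1 x with h2 | h2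
  · rw [uIcc_of_le h2] at hy; exact zero_lt_one.trans_le hy.1
  · rw [uIcc_of_ge h2] at hy; exact hx.trans_le hy.1

theorem BB.hasDerivAt_integral {β : ℝ} {g : ℝ → ℝ} (h : BB β g) (hβ : -1 < β) {x : ℝ} (hx : 0 < x) :
    HasDerivAt (fun x => ∫ t in (0 : ℝ)..x, g t) (g x) x := by
  refine intervalIntegral.integral_hasDerivAt_right (h.intervalIntegrable hβ hx) ?_
    (h.continuousOn.continuousAt (Ioi_mem_nhds hx))
  exact h.continuousOn.stronglyMeasurableAtFilter isOpen_Ioi x hx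

theorem BB.integral {β : ℝ} {g : ℝ → ℝ} (h : BB β g) (hβ : -1 < β) :
    BB (β + 1) (fun x => ∫ t in (0 : ℝ)..x, g t) := by
  refine BB.of_theta ?_ ?_ ?_
  · obtain ⟨C, h0, hC⟩ := h.bound
    refine ⟨C / (β + 1), fun x hx => ?_⟩
    have hi : IntervalIntegrable (fun x : ℝ => C * x ^ β) volume 0 x :=
      (intervalIntegral.intervalIntegrable_rpow' hβ).const_mul C
    have := intervalIntegral.norm_integral_le_of_norm_le (f := g) (g := fun x => C * x ^ β)
      hx.1.le (Eventually.of_forall fun t ht => hC t ⟨ht.1, ht.2.trans hx.2⟩) hi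
    rw [intervalIntegral.integral_const_mul, integral_rpow (Or.inl hβ),
      Real.zero_rpow (by linarith), sub_zero] at this
    rw [Real.norm_eq_abs] at this
    refine this.trans (le_of_eq (by ring))
  · exact fun x hx => (h.hasDerivAt_integral hβ hx).differentiableAt.differentiableWithinAt
  · have := (BB.rpow 1).mul h
    rw [add_comm] at this
    refine this.congr fun x hx => ?_
    simp only [_root_.theta, (h.hasDerivAt_integral hβ hx).deriv, Real.rpow_one]

/-- functions vanishing on the left, in the class with `γ > 0`, are continuous -/
theorem BB.hasDerivAt_zero {γ : ℝ} {u : ℝ → ℝ} (h : BB γ u) (hγ : 1 < γ) (h0 : ∀ x ≤ 0, u x = 0) :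
    HasDerivAt u 0 0 := by
  obtain ⟨C, hC0, hC⟩ := h.bound
  rw [hasDerivAt_iff_isLittleO]
  simp only [h0 0 le_rfl, sub_zero, smul_zero]
  have h1 : u =O[𝓝 0] fun x => |x| ^ γ := by
    refine Asymptotics.IsBigO.of_bound C ?_
    filter_upwards [Iio_mem_nhds (zero_lt_one (α := ℝ))] with x hx
    rcases le_or_gt x 0 with h2 | h2
    · rw [h0 x h2]; simp; positivity
    · have := hC x ⟨h2, hx.le⟩
      rw [Real.norm_eq_abs, abs_of_pos h2]
      rwa [Real.norm_of_nonneg (Real.rpow_nonneg h2.le _)]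
  refine h1.trans_isLittleO ?_
  have h2 : (fun x : ℝ => |x| ^ (γ - 1) * |x|) =o[𝓝 0] fun x => 1 * |x| := by
    refine Asymptotics.IsLittleO.mul_isBigO ?_ (Asymptotics.isBigO_refl _ _)
    rw [Asymptotics.isLittleO_one_iff]
    have : ContinuousAt (fun x : ℝ => |x| ^ (γ - 1)) 0 :=
      (continuous_abs.continuousAt).rpow_const (Or.inr (by linarith))
    have h3 := this.tendsto
    simpa [Real.zero_rpow (show γ - 1 ≠ 0 by linarith)] using h3
  have h3 : (fun x : ℝ => |x| ^ (γ - 1) * |x|) = fun x => |x| ^ γ := by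
    funext x
    rcases eq_or_ne x 0 with rfl | hx
    · simp [Real.zero_rpow (show γ ≠ 0 by linarith)]
    · rw [Real.rpow_sub_one (abs_ne_zero.2 hx)]; field_simp
  rw [h3] at h2
  refine h2.trans_isBigO ?_
  simp only [one_mul]
  exact Asymptotics.isBigO_abs_left.2 (Asymptotics.isBigO_refl _ _)

theorem BB.continuous {γ : ℝ} {u : ℝ → ℝ} (h : BB γ u) (hγ : 0 < γ) (h0 : ∀ x ≤ 0, u x = 0) :
    Continuous u := by
  rw [continuous_iff_continuousAt]
  intro x
  rcases lt_trichotomy x 0 with hx | rfl | hx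
  · have : u =ᶠ[𝓝 x] fun _ => 0 := by
      filter_upwards [Iio_mem_nhds hx] with y hy using h0 y (le_of_lt hy)
    exact (continuousAt_const.congr this.symm)
  · obtain ⟨C, hC0, hC⟩ := h.bound
    have h3 : Tendsto (fun x : ℝ => C * |x| ^ γ) (𝓝 0) (𝓝 0) := by
      have : ContinuousAt (fun x : ℝ => C * |x| ^ γ) 0 :=
        continuousAt_const.mul ((continuous_abs.continuousAt).rpow_const (Or.inr hγ.le))
      simpa [Real.zero_rpow hγ.ne'] using this.tendsto
    rw [ContinuousAt, h0 0 le_rfl]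
    refine squeeze_zero_norm' ?_ h3
    filter_upwards [Iio_mem_nhds (zero_lt_one (α := ℝ))] with x hx
    rcases le_or_gt x 0 with h2 | h2
    · rw [h0 x h2]; simp; positivity
    · have := hC x ⟨h2, hx.le⟩
      rwa [Real.norm_eq_abs, abs_of_pos h2]
  · exact h.continuousOn.continuousAt (Ioi_mem_nhds hx)

theorem BB.deriv_left {γ : ℝ} {u : ℝ → ℝ} (h : BB γ u) (hγ : 1 < γ) (h0 : ∀ x ≤ 0, u x = 0) :
    ∀ x ≤ 0, _root_.deriv u x = 0 := by
  intro x hx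
  rcases hx.lt_or_eq with hx | rfl
  · have : u =ᶠ[𝓝 x] fun _ => 0 := by
      filter_upwards [Iio_mem_nhds hx] with y hy using h0 y (le_of_lt hy)
    rw [this.deriv_eq]; simp
  · exact (h.hasDerivAt_zero hγ h0).deriv

theorem BB.differentiable {γ : ℝ} {u : ℝ → ℝ} (h : BB γ u) (hγ : 1 < γ) (h0 : ∀ x ≤ 0, u x = 0) :
    Differentiable ℝ u := by
  intro x
  rcases lt_trichotomy x 0 with hx | rfl | hx
  · have : u =ᶠ[𝓝 x] fun _ => 0 := by
      filter_upwards [Iio_mem_nhds hx] with y hy using h0 y (le_of_lt hy)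
    exact (differentiableAt_const (0 : ℝ)).congr_of_eventuallyEq this
  · exact (h.hasDerivAt_zero hγ h0).differentiableAt
  · exact diffAt_of h.diff hx

theorem BB.contDiff {γ : ℝ} {u : ℝ → ℝ} (k : ℕ) (h : BB γ u) (hγ : k < γ) (h0 : ∀ x ≤ 0, u x = 0) :
    ContDiff ℝ k u := by
  induction k generalizing u γ with
  | zero => exact contDiff_zero.2 (h.continuous (by simpa using hγ) h0)
  | succ k ih =>
    push_cast at hγ ⊢
    have h1 : 1 < γ := by have : (0 : ℝ) ≤ k := k.cast_nonneg; linarith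
    rw [contDiff_succ_iff_deriv]
    exact ⟨h.differentiable h1 h0, by simp, ih h.deriv (by linarith) (h.deriv_left h1 h0)⟩

/-- Hölder estimate. -/
theorem BB.holder {β : ℝ} {g : ℝ → ℝ} (h : BB β g) (hβ : 0 < β) (hβ1 : β ≤ 1)
    (h0 : ∀ x ≤ 0, g x = 0) :
    ∃ C : ℝ, ∀ x ∈ Icc (0 : ℝ) 1, ∀ y ∈ Icc (0 : ℝ) 1, |g x - g y| ≤ C * |x - y| ^ β := by
  obtain ⟨C, hC0, hC⟩ := h.deriv.bound
  refine ⟨C / β, ?_⟩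
  have hcont := h.continuous hβ h0
  have hpow : ∀ x : ℝ, 0 < x → HasDerivAt (fun x : ℝ => C / β * x ^ β) (C * x ^ (β - 1)) x := by
    intro x hx
    have := (Real.hasDerivAt_rpow_const (p := β) (Or.inl (ne_of_gt hx))).const_mul (C / β)
    rwa [← mul_assoc, div_mul_cancel₀ _ hβ.ne'] at this
  have hcp : Continuous (fun x : ℝ => C / β * x ^ β) :=
    continuous_const.mul (Real.continuous_rpow_const hβ.le)
  have m1 : MonotoneOn (fun x : ℝ => C / β * x ^ β - g x) (Icc 0 1) := by
    refine monotoneOn_of_deriv_nonneg (convex_Icc 0 1) (hcp.sub hcont).continuousOn ?_ ?_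
    · rw [interior_Icc]
      exact fun x hx => ((hpow x hx.1).differentiableAt.sub
        (diffAt_of h.diff hx.1)).differentiableWithinAt
    · rw [interior_Icc]
      intro x hx
      rw [((hpow x hx.1).fun_sub (diffAt_of h.diff hx.1).hasDerivAt).deriv]
      have := (abs_le.1 (hC x ⟨hx.1, hx.2.le⟩)).2
      linarith
  have m2 : MonotoneOn (fun x : ℝ => C / β * x ^ β + g x) (Icc 0 1) := by
    refine monotoneOn_of_deriv_nonneg (convex_Icc 0 1) (hcp.add hcont).continuousOn ?_ ?_
    · rw [interior_Icc]
      exact fun x hx => ((hpow x hx.1).differentiableAt.add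
        (diffAt_of h.diff hx.1)).differentiableWithinAt
    · rw [interior_Icc]
      intro x hx
      rw [((hpow x hx.1).fun_add (diffAt_of h.diff hx.1).hasDerivAt).deriv]
      have := (abs_le.1 (hC x ⟨hx.1, hx.2.le⟩)).1
      linarith
  have main : ∀ x ∈ Icc (0 : ℝ) 1, ∀ y ∈ Icc (0 : ℝ) 1, x ≤ y →
      |g x - g y| ≤ C / β * |x - y| ^ β := by
    intro x hx y hy hxy
    have e1 := m1 hx hy hxy
    have e2 := m2 hx hy hxy
    simp only at e1 e2
    have e3 : y ^ β ≤ x ^ β + (y - x) ^ β := by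
      have := Real.rpow_add_le_add_rpow hx.1 (sub_nonneg.2 hxy) hβ.le hβ1
      simpa using this
    have e4 := mul_le_mul_of_nonneg_left e3 (div_nonneg hC0 hβ.le)
    rw [abs_sub_comm x y, abs_of_nonneg (sub_nonneg.2 hxy), abs_le]
    constructor <;> linarith
  intro x hx y hy
  rcases le_total x y with hxy | hxy
  · exact main x hx y hy hxy
  · rw [abs_sub_comm, abs_sub_comm x y]; exact main y hy x hx hxy

end BClass

noncomputable section Red

/-- Symmetrised integrand. -/
def DD (s : ℝ) (u : ℝ → ℝ) (x h : ℝ) : ℝ := (2 * u x - u (x + h) - u (x - h)) / h ^ (1 + 2 * s)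

theorem fracTrunc_eq {s : ℝ} {u : ℝ → ℝ} {x : ℝ} (hs : 0 < s) (hu : Continuous u)
    (hM : ∃ M : ℝ, ∀ x, |u x| ≤ M) {ε : ℝ} (hε : 0 < ε) :
    fracTrunc s u x ε = ∫ h in Ici ε, DD s u x h := by
  obtain ⟨M, hM⟩ := hM
  have hcover : IntegrableOn (fun h : ℝ => 2 * M * h ^ (-(1 + 2 * s))) (Ici ε) :=
    (integrableOn_Ici_iff_integrableOn_Ioi).2
      ((integrableOn_Ioi_rpow_of_lt (by linarith) hε).const_mul _)
  have hgen : ∀ v : ℝ → ℝ, Continuous v → (∀ x, |v x| ≤ M) →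
      IntegrableOn (fun h => (u x - v h) / |h| ^ (1 + 2 * s)) (Ici ε) := by
    intro v hv hvM
    refine Integrable.mono' hcover ?_ ?_
    · refine ContinuousOn.aestronglyMeasurable (fun h hh => ?_) measurableSet_Ici
      have hh' : 0 < |h| := abs_pos.2 (hε.trans_le hh).ne'
      refine ContinuousAt.continuousWithinAt ?_
      refine (continuousAt_const.sub hv.continuousAt).div
        (continuous_abs.continuousAt.rpow_const (Or.inl hh'.ne')) (Real.rpow_pos_of_pos hh' _).ne'
    · filter_upwards [ae_restrict_mem measurableSet_Ici] with h hh
      have hh' : 0 < h := hε.trans_le hh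
      rw [Real.norm_eq_abs, abs_div, abs_of_pos hh', abs_of_pos (Real.rpow_pos_of_pos hh' _),
        Real.rpow_neg hh'.le, ← div_eq_mul_inv]
      gcongr
      have h1 := abs_le.1 (hM x)
      have h2 := abs_le.1 (hvM h)
      rw [abs_le]; constructor <;> linarith
  have i1 := hgen (fun h => u (x + h)) (by fun_prop) (fun h => hM _)
  have i2 := hgen (fun h => u (x - h)) (by fun_prop) (fun h => hM _)
  set F : ℝ → ℝ := fun y => (u x - u y) / |x - y| ^ (1 + 2 * s) with hF
  have m1 : MeasurePreserving (fun h : ℝ => x + h) volume volume := measurePreserving_add_left volume x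
  have e1 : MeasurableEmbedding (fun h : ℝ => x + h) := measurableEmbedding_addLeft x
  have m2 : MeasurePreserving (fun h : ℝ => x - h) volume volume := Measure.measurePreserving_sub_left volume x
  have e2 : MeasurableEmbedding (fun h : ℝ => x - h) :=
    (MeasurableEquiv.subLeft x).measurableEmbedding
  have p1 : (fun h : ℝ => x + h) ⁻¹' (Ici (x + ε)) = Ici ε := by ext; simp
  have p2 : (fun h : ℝ => x - h) ⁻¹' (Iic (x - ε)) = Ici ε := by ext; simp
  have f1 : (F ∘ fun h : ℝ => x + h) = fun h => (u x - u (x + h)) / |h| ^ (1 + 2 * s) := by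
    funext h; simp [hF]
  have f2 : (F ∘ fun h : ℝ => x - h) = fun h => (u x - u (x - h)) / |h| ^ (1 + 2 * s) := by
    funext h; simp [hF]
  have j1 : IntegrableOn F (Ici (x + ε)) := by
    rw [← m1.integrableOn_comp_preimage e1, p1, f1]; exact i1
  have j2 : IntegrableOn F (Iic (x - ε)) := by
    rw [← m2.integrableOn_comp_preimage e2, p2, f2]; exact i2
  have k1 : ∫ y in Ici (x + ε), F y = ∫ h in Ici ε, (u x - u (x + h)) / |h| ^ (1 + 2 * s) := by
    rw [← m1.setIntegral_preimage_emb e1, p1, ← f1]; rfl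
  have k2 : ∫ y in Iic (x - ε), F y = ∫ h in Ici ε, (u x - u (x - h)) / |h| ^ (1 + 2 * s) := by
    rw [← m2.setIntegral_preimage_emb e2, p2, ← f2]; rfl
  have hset : {y : ℝ | ε ≤ |x - y|} = Iic (x - ε) ∪ Ici (x + ε) := by
    ext y
    simp only [mem_ofPred_eq, mem_union, mem_Iic, mem_Ici, le_abs]
    constructor <;> rintro (h | h) <;> first | (left; linarith) | (right; linarith)
  have hdisj : Disjoint (Iic (x - ε)) (Ici (x + ε)) := by
    rw [Set.disjoint_left]
    intro y hy hy'
    simp only [mem_Iic, mem_Ici] at hy hy'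
    linarith
  rw [fracTrunc, hset, setIntegral_union hdisj measurableSet_Ici j2 j1, k1, k2,
    ← integral_add i2 i1]
  refine setIntegral_congr_fun measurableSet_Ici fun h hh => ?_
  have hh' : 0 < h := hε.trans_le hh
  simp only [DD, abs_of_pos hh']
  rw [← add_div]
  congr 1
  ring

theorem hasFracLap_of {s : ℝ} {u : ℝ → ℝ} {x : ℝ} (hs : 0 < s) (hu : Continuous u)
    (hM : ∃ M : ℝ, ∀ x, |u x| ≤ M) (hint : IntegrableOn (DD s u x) (Ioi 0)) :
    HasFracLap s u x (fracConst s * ∫ h in Ioi 0, DD s u x h) := by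
  refine ⟨_, ?_, rfl⟩
  have hc : AECover (volume.restrict (Ioi (0 : ℝ))) (𝓝[>] (0 : ℝ)) fun ε : ℝ => Ici ε :=
    aecover_Ioi_of_Ici (tendsto_nhdsWithin_of_tendsto_nhds tendsto_id)
  refine (hc.integral_tendsto_of_countably_generated hint).congr' ?_
  filter_upwards [self_mem_nhdsWithin] with ε hε
  rw [fracTrunc_eq hs hu hM hε, Measure.restrict_restrict measurableSet_Ici,
    inter_eq_left.2 (show Ici ε ⊆ Ioi 0 from fun y hy => mem_Ioi.2 (lt_of_lt_of_le (mem_Ioi.1 hε) (mem_Ici.1 hy)))]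

theorem kernel_BB {S : (ℝ → ℝ) → Prop} {W : (ℝ → ℝ) → ℝ → ℝ → ℝ} {μ : Measure ℝ} {γ : ℝ}
    {b : ℝ → ℝ} (hS : ∀ u, S u → S (theta u))
    (hmeas : ∀ u, S u → ∀ x > 0, AEStronglyMeasurable (W u x) μ)
    (hb : Integrable b μ) (hb0 : ∀ᵐ t ∂μ, 0 ≤ b t)
    (hbound : ∀ u, S u → ∃ C : ℝ, 0 ≤ C ∧ ∀ᵐ t ∂μ, ∀ x > 0, |W u x t| ≤ C * x ^ γ * b t)
    (hder : ∀ u, S u → ∀ᵐ t ∂μ, ∀ x > 0,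
      HasDerivAt (fun x => W u x t) (W (theta u) x t / x) x) :
    ∀ u, S u → (∀ x > 0, Integrable (W u x) μ) ∧ BB γ (fun x => ∫ t, W u x t ∂μ) := by
  have hint : ∀ u, S u → ∀ x > 0, Integrable (W u x) μ := by
    intro u hu x hx
    obtain ⟨C, hC0, hC⟩ := hbound u hu
    refine Integrable.mono' (hb.const_mul (C * x ^ γ)) (hmeas u hu x hx) ?_
    filter_upwards [hC] with t ht using ht x hx
  have hB : ∀ u, S u → ∃ C : ℝ, ∀ x ∈ Ioc (0 : ℝ) 1, |∫ t, W u x t ∂μ| ≤ C * x ^ γ := by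
    intro u hu
    obtain ⟨C, hC0, hC⟩ := hbound u hu
    refine ⟨C * ∫ t, b t ∂μ, fun x hx => ?_⟩
    have := norm_integral_le_of_norm_le (f := W u x) (hb.const_mul (C * x ^ γ))
      (by filter_upwards [hC] with t ht using ht x hx.1)
    rw [integral_const_mul] at this
    refine this.trans (le_of_eq (by ring))
  have hD : ∀ u, S u → ∀ x > 0,
      HasDerivAt (fun x => ∫ t, W u x t ∂μ) ((∫ t, W (theta u) x t ∂μ) / x) x := by
    intro u hu x hx
    obtain ⟨C, hC0, hC⟩ := hbound _ (hS u hu)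
    obtain ⟨D, hD⟩ := (isCompact_Icc (a := x / 2) (b := 2 * x)).exists_bound_of_continuousOn
      (f := fun y : ℝ => C * y ^ γ / y) (by
        intro y hy
        have hy' : y ≠ 0 := (lt_of_lt_of_le (by linarith) hy.1).ne'
        exact ((continuousAt_const.mul (Real.continuousAt_rpow_const _ _ (Or.inl hy'))).div
          continuousAt_id hy').continuousWithinAt)
    have := (hasDerivAt_integral_of_dominated_loc_of_deriv_le (μ := μ) (𝕜 := ℝ)
      (F := fun y t => W u y t) (F' := fun y t => W (theta u) y t / y) (x₀ := x)
      (s := Ioo (x / 2) (2 * x)) (bound := fun t => D * b t)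
      (Ioo_mem_nhds (by linarith) (by linarith))
      (by filter_upwards [Ioi_mem_nhds hx] with y hy using hmeas u hu y hy)
      (hint u hu x hx) ((hint _ (hS u hu) x hx).div_const x).aestronglyMeasurable
      (by
        filter_upwards [hC, hb0] with t ht h0 y hy
        have hy' : 0 < y := lt_trans (by linarith) hy.1
        rw [norm_div, Real.norm_eq_abs, Real.norm_of_nonneg hy'.le]
        have h1 := ht y hy'
        have h2 := (le_abs_self _).trans (hD y ⟨hy.1.le, hy.2.le⟩)
        calc |W (theta u) y t| / y ≤ (C * y ^ γ * b t) / y := by gcongr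
          _ = (C * y ^ γ / y) * b t := by ring
          _ ≤ _ := by gcongr)
      (hb.const_mul D)
      (by
        filter_upwards [hder u hu] with t ht y hy
        exact ht y (lt_trans (by linarith) hy.1))).2
    rw [integral_div] at this
    exact this
  intro u hu
  refine ⟨hint u hu, fun m => ?_⟩
  induction m generalizing u with
  | zero => exact hB u hu
  | succ m ih =>
    refine ⟨hB u hu, fun x hx => (hD u hu x hx).differentiableAt.differentiableWithinAt,
      (ih _ (hS u hu)).congr fun x hx => ?_⟩
    have : x ≠ 0 := ne_of_gt hx
    simp only [theta]
    rw [(hD u hu x hx).deriv]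
    field_simp

/-- class with support condition -/
def GB (γ : ℝ) (u : ℝ → ℝ) : Prop := BB γ u ∧ ∀ x > 3 / 4, u x = 0

theorem GB.theta {γ u} (h : GB γ u) : GB γ (theta u) := by
  refine ⟨h.1.theta, fun x hx => ?_⟩
  have : u =ᶠ[𝓝 x] fun _ => 0 := by
    filter_upwards [Ioi_mem_nhds hx] with y hy using h.2 y hy
  simp [_root_.theta, this.deriv_eq]

theorem GB.bound {γ u} (h : GB γ u) : ∃ C : ℝ, 0 ≤ C ∧ ∀ x > 0, |u x| ≤ C * x ^ γ := by
  obtain ⟨C, h0, hC⟩ := h.1.bound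
  refine ⟨C, h0, fun x hx => ?_⟩
  rcases le_or_gt x 1 with h1 | h1
  · exact hC x ⟨hx, h1⟩
  · rw [h.2 x (by linarith), abs_zero]; positivity

theorem theta_comp {γ : ℝ} {u : ℝ → ℝ} (h : BB γ u) {a x : ℝ} (ha : 0 < a) (hx : 0 < x) :
    HasDerivAt (fun x => u (x * a)) (theta u (x * a) / x) x := by
  have h1 := (diffAt_of h.diff (mul_pos hx ha)).hasDerivAt
  have h2 : HasDerivAt (fun x : ℝ => x * a) a x := by
    simpa using (hasDerivAt_id x).mul_const a
  have := h1.comp x h2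
  refine this.congr_deriv ?_
  simp only [theta]; field_simp

theorem second_diff {γ : ℝ} {u : ℝ → ℝ} (h : GB γ u) :
    ∃ C : ℝ, 0 ≤ C ∧ ∀ t ∈ Ioc (0 : ℝ) (1 / 2), ∀ x > 0,
      |2 * u x - u (x * (1 + t)) - u (x * (1 - t))| ≤ C * x ^ γ * t ^ 2 := by
  -- bound for the second derivative
  obtain ⟨C1, h10, hC1⟩ := h.theta.bound
  obtain ⟨C2, h20, hC2⟩ := h.theta.theta.bound
  obtain ⟨D, hD⟩ := (isCompact_Icc (a := (1 / 2 : ℝ)) (b := 3 / 2)).exists_bound_of_continuousOn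
      (f := fun y : ℝ => y ^ (γ - 2)) (by
        intro y hy
        have hy' : y ≠ 0 := (lt_of_lt_of_le (by norm_num) hy.1).ne'
        exact (Real.continuousAt_rpow_const _ _ (Or.inl hy')).continuousWithinAt)
  have hD0 : 0 ≤ D := (norm_nonneg _).trans (hD 1 (by norm_num))
  have hdd : ∀ y > 0, HasDerivAt (deriv u) ((theta (theta u) y - theta u y) / y ^ 2) y := by
    intro y hy
    have h1 := (diffAt_of h.1.deriv.diff hy).hasDerivAt
    refine h1.congr_deriv ?_
    have : deriv (theta u) y = 1 * deriv u y + y * deriv (deriv u) y :=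
      ((hasDerivAt_id y).fun_mul h1).deriv
    simp only [theta] at this ⊢
    rw [this]; field_simp; ring
  refine ⟨(C1 + C2) * D * 2, by positivity, fun t ht x hx => ?_⟩
  have hdb : ∀ y ∈ Icc (x * (1 / 2)) (x * (3 / 2)),
      ‖deriv (deriv u) y‖ ≤ (C1 + C2) * D * x ^ (γ - 2) := by
    intro y hy
    have hy0 : 0 < y := lt_of_lt_of_le (by linarith) hy.1
    rw [(hdd y hy0).deriv, norm_div, Real.norm_eq_abs, Real.norm_eq_abs, abs_of_pos (pow_pos hy0 2)]
    have e1 : |theta (theta u) y - theta u y| ≤ (C1 + C2) * y ^ γ := by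
      refine (abs_sub _ _).trans ?_
      have := hC1 y hy0
      have := hC2 y hy0
      linarith
    have e2 : y ^ γ / y ^ 2 = y ^ (γ - 2) := by
      rw [Real.rpow_sub hy0]; norm_cast
    have e3 : y ^ (γ - 2) ≤ D * x ^ (γ - 2) := by
      have h3 : y = (y / x) * x := by field_simp
      have h4 : y / x ∈ Icc (1 / 2 : ℝ) (3 / 2) := by
        constructor
        · rw [le_div_iff₀ hx]; linarith [hy.1]
        · rw [div_le_iff₀ hx]; linarith [hy.2]
      have h5 := (le_abs_self _).trans (hD _ h4)
      rw [h3, Real.mul_rpow (by positivity) hx.le]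
      gcongr
    calc _ ≤ (C1 + C2) * y ^ γ / y ^ 2 := by gcongr
      _ = (C1 + C2) * y ^ (γ - 2) := by rw [mul_div_assoc, e2]
      _ ≤ (C1 + C2) * (D * x ^ (γ - 2)) := by gcongr
      _ = _ := by ring
  have hlip : ∀ τ ∈ Icc 0 t, |deriv u (x * (1 + τ)) - deriv u (x * (1 - τ))| ≤
      (C1 + C2) * D * x ^ (γ - 2) * (2 * x * t) := by
    intro τ hτ
    have hτ2 : τ ≤ 1 / 2 := hτ.2.trans ht.2
    have := Convex.norm_image_sub_le_of_norm_deriv_le (f := deriv u)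
      (s := Icc (x * (1 / 2)) (x * (3 / 2))) (x := x * (1 - τ)) (y := x * (1 + τ))
      (fun y hy => (hdd y (lt_of_lt_of_le (by linarith) hy.1)).differentiableAt) hdb (convex_Icc _ _)
      ⟨by gcongr; linarith, by gcongr; linarith [hτ.1]⟩
      ⟨by gcongr; linarith [hτ.1], by gcongr; linarith⟩
    refine this.trans ?_
    gcongr
    rw [Real.norm_eq_abs, show x * (1 + τ) - x * (1 - τ) = 2 * x * τ by ring,
      abs_of_nonneg (by have := hτ.1; positivity)]
    gcongr
    exact hτ.2
  have hder : ∀ τ ∈ Icc 0 t, HasDerivAt (fun τ => 2 * u x - u (x * (1 + τ)) - u (x * (1 - τ)))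
      (-(deriv u (x * (1 + τ)) - deriv u (x * (1 - τ))) * x) τ := by
    intro τ hτ
    have hτ2 : τ ≤ 1 / 2 := hτ.2.trans ht.2
    have a1 : HasDerivAt (fun τ : ℝ => x * (1 + τ)) x τ := by
      simpa using ((hasDerivAt_id τ).const_add 1).const_mul x
    have a2 : HasDerivAt (fun τ : ℝ => x * (1 - τ)) (-x) τ := by
      simpa using ((hasDerivAt_id τ).const_sub 1).const_mul x
    have b1 := (diffAt_of h.1.diff (show 0 < x * (1 + τ) from
      mul_pos hx (by linarith [hτ.1]))).hasDerivAt.comp τ a1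
    have b2 := (diffAt_of h.1.diff (show 0 < x * (1 - τ) from
      mul_pos hx (by linarith))).hasDerivAt.comp τ a2
    refine ((b1.const_sub (2 * u x)).sub b2).congr_deriv ?_
    ring
  have := Convex.norm_image_sub_le_of_norm_hasDerivWithin_le
    (f := fun τ => 2 * u x - u (x * (1 + τ)) - u (x * (1 - τ)))
    (s := Icc 0 t) (x := 0) (y := t) (C := (C1 + C2) * D * x ^ (γ - 2) * (2 * x * t) * x)
    (fun τ hτ => (hder τ hτ).hasDerivWithinAt) (fun τ hτ => by
      rw [norm_mul, norm_neg, Real.norm_of_nonneg hx.le]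
      gcongr
      exact hlip τ hτ) (convex_Icc _ _) ⟨le_rfl, ht.1.le⟩ ⟨ht.1.le, le_rfl⟩
  simp only [add_zero, mul_one, sub_zero, Real.norm_eq_abs, abs_of_pos ht.1] at this
  rw [show 2 * u x - u x - u x = 0 by ring, sub_zero] at this
  refine this.trans (le_of_eq ?_)
  rw [Real.rpow_sub hx]
  norm_cast
  field_simp

end Red

noncomputable section Ker

/-- Far kernel. -/
def kInd (p t : ℝ) : ℝ := if 1 / 2 < |1 - t| then |1 - t| ^ (-p) else 0

theorem kInd_meas (p : ℝ) : Measurable (kInd p) := by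
  unfold kInd
  refine Measurable.ite ?_ (by fun_prop) measurable_const
  exact measurableSet_lt measurable_const (by fun_prop)

theorem kInd_bound {p : ℝ} (hp : 0 < p) (t : ℝ) : |kInd p t| ≤ 2 ^ p := by
  unfold kInd
  split_ifs with h
  · rw [abs_of_nonneg (Real.rpow_nonneg (abs_nonneg _) _)]
    have h1 : (2 : ℝ) ^ p = (1 / 2) ^ (-p) := by
      rw [Real.rpow_neg (by norm_num), one_div, Real.inv_rpow (by norm_num), inv_inv]
    rw [h1]
    exact Real.rpow_le_rpow_of_nonpos (by norm_num) h.le (by linarith)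
  · simp; positivity

theorem taylor_ker (p : ℝ) (N : ℕ) : ∃ (b : ℕ → ℝ) (C : ℝ), ∀ z ∈ Icc (0 : ℝ) (2 / 3),
    |(1 - z) ^ (-p) - ∑ n ∈ Finset.range N, b n * z ^ n| ≤ C * z ^ N := by
  have hcd : ∀ n : ℕ, ContDiffOn ℝ n (fun z : ℝ => (1 - z) ^ (-p)) (Icc 0 (2 / 3)) := by
    intro n z hz
    have : (1 : ℝ) - z ≠ 0 := by have := hz.2; linarith
    exact ((contDiffAt_const.sub contDiffAt_id).rpow_const_of_ne this).contDiffWithinAt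
  cases N with
  | zero =>
    obtain ⟨C, hC⟩ := (isCompact_Icc (a := (0 : ℝ)) (b := 2 / 3)).exists_bound_of_continuousOn
      (hcd 0).continuousOn
    exact ⟨0, C, fun z hz => by simpa using hC z hz⟩
  | succ n =>
    obtain ⟨C, hC⟩ := exists_taylor_mean_remainder_bound (f := fun z : ℝ => (1 - z) ^ (-p))
      (a := 0) (b := 2 / 3) (n := n) (by norm_num) (by exact_mod_cast hcd (n + 1))
    refine ⟨fun k => (k.factorial : ℝ)⁻¹ *
      iteratedDerivWithin k (fun z : ℝ => (1 - z) ^ (-p)) (Icc 0 (2 / 3)) 0, C, fun z hz => ?_⟩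
    have := hC z hz
    rw [taylor_within_apply, sub_zero, Real.norm_eq_abs] at this
    refine le_trans (le_of_eq ?_) this
    congr 2
    refine Finset.sum_congr rfl fun k _ => ?_
    rw [smul_eq_mul]; ring

theorem ker_integrable {p γ : ℝ} (N : ℕ) (hp : 1 < p) (hγ : -1 < γ) (h1 : γ - p - N < -1)
    (h2 : ∀ n < N, -1 < γ - p - n) : ∃ b : ℕ → ℝ,
    IntegrableOn (fun t : ℝ => t ^ γ *
      (kInd p t - ∑ n ∈ Finset.range N, b n * t ^ (-p - n))) (Ioi 0) := by
  obtain ⟨b, C, hC⟩ := taylor_ker p N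
  refine ⟨b, ?_⟩
  have hmeas : Measurable (fun t : ℝ => t ^ γ *
      (kInd p t - ∑ n ∈ Finset.range N, b n * t ^ (-p - n))) := by
    have := kInd_meas p
    fun_prop
  rw [← Ioc_union_Ioi_eq_Ioi (show (0 : ℝ) ≤ 3 / 2 by norm_num)]
  refine IntegrableOn.union ?_ ?_
  · have i1 : IntegrableOn (fun t : ℝ => t ^ γ * kInd p t) (Ioc 0 (3 / 2)) := by
      have : IntegrableOn (fun t : ℝ => t ^ γ * 2 ^ p) (Ioc 0 (3 / 2)) := by
        rw [← intervalIntegrable_iff_integrableOn_Ioc_of_le (by norm_num)]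
        exact (intervalIntegral.intervalIntegrable_rpow' hγ).mul_const _
      have hk := kInd_meas p
      refine Integrable.mono' this (by fun_prop) ?_
      filter_upwards [ae_restrict_mem measurableSet_Ioc] with t ht
      rw [norm_mul, Real.norm_of_nonneg (Real.rpow_nonneg ht.1.le _)]
      exact mul_le_mul_of_nonneg_left (kInd_bound (by linarith) t) (Real.rpow_nonneg ht.1.le _)
    have i2 : IntegrableOn (fun t : ℝ => ∑ n ∈ Finset.range N, b n * t ^ (γ - p - n))
        (Ioc 0 (3 / 2)) := by
      refine integrable_finsetSum _ fun n hn => ?_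
      have : IntegrableOn (fun t : ℝ => b n * t ^ (γ - p - n)) (Ioc 0 (3 / 2)) := by
        rw [← intervalIntegrable_iff_integrableOn_Ioc_of_le (by norm_num)]
        exact (intervalIntegral.intervalIntegrable_rpow' (h2 n (Finset.mem_range.1 hn))).const_mul _
      exact this
    refine (i1.sub i2).congr ?_
    filter_upwards [ae_restrict_mem measurableSet_Ioc] with t ht
    simp only [Pi.sub_apply]
    rw [mul_sub, Finset.mul_sum]
    congr 1
    refine Finset.sum_congr rfl fun n _ => ?_
    rw [show γ - p - n = γ + (-p - n) by ring, Real.rpow_add ht.1]; ring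
  · have i1 : IntegrableOn (fun t : ℝ => C * t ^ (γ - p - N)) (Ioi (3 / 2)) :=
      (integrableOn_Ioi_rpow_of_lt h1 (by norm_num)).const_mul _
    refine Integrable.mono' i1 hmeas.aestronglyMeasurable ?_
    filter_upwards [ae_restrict_mem measurableSet_Ioi] with t ht
    have ht1 : 3 / 2 < t := ht
    have ht0 : 0 < t := by linarith
    have hk : kInd p t = t ^ (-p) * (1 - t⁻¹) ^ (-p) := by
      unfold kInd
      have e1 : |1 - t| = t - 1 := by rw [abs_sub_comm]; exact abs_of_pos (by linarith)
      rw [e1, if_pos (by linarith), ← Real.mul_rpow ht0.le]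
      · congr 1; field_simp
      · rw [sub_nonneg]; exact inv_le_one_of_one_le₀ (by linarith)
    have hs : ∑ n ∈ Finset.range N, b n * t ^ (-p - n) =
        t ^ (-p) * ∑ n ∈ Finset.range N, b n * t⁻¹ ^ n := by
      rw [Finset.mul_sum]
      refine Finset.sum_congr rfl fun n _ => ?_
      rw [Real.rpow_sub ht0, Real.rpow_natCast, inv_pow]; ring
    have hz : t⁻¹ ∈ Icc (0 : ℝ) (2 / 3) := by
      refine ⟨by positivity, ?_⟩
      rw [inv_le_comm₀ ht0 (by norm_num)]; linarith
    have := hC _ hz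
    rw [hk, hs, ← mul_sub, norm_mul, norm_mul, Real.norm_of_nonneg (Real.rpow_nonneg ht0.le _),
      Real.norm_of_nonneg (Real.rpow_nonneg ht0.le _), Real.norm_eq_abs]
    calc _ ≤ t ^ γ * (t ^ (-p) * (C * t⁻¹ ^ N)) := by gcongr
      _ = C * t ^ (γ - p - N) := by
        rw [Real.rpow_sub ht0, Real.rpow_sub ht0, Real.rpow_natCast, Real.rpow_neg ht0.le, inv_pow]
        field_simp

theorem near_BB {s γ : ℝ} (hs1 : s < 1) (u : ℝ → ℝ) (hu : GB γ u) :
    (∀ x > 0, Integrable (fun t => (2 * u x - u (x * (1 + t)) - u (x * (1 - t))) * t ^ (-(1 + 2 * s)))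
      (volume.restrict (Ioc 0 (1 / 2)))) ∧
    BB γ (fun x => ∫ t in Ioc 0 (1 / 2),
      (2 * u x - u (x * (1 + t)) - u (x * (1 - t))) * t ^ (-(1 + 2 * s))) := by
  refine kernel_BB (S := GB γ) (μ := volume.restrict (Ioc 0 (1 / 2)))
    (W := fun u x t => (2 * u x - u (x * (1 + t)) - u (x * (1 - t))) * t ^ (-(1 + 2 * s)))
    (b := fun t => t ^ (1 - 2 * s)) (fun u hu => hu.theta) ?_ ?_ ?_ ?_ ?_ u hu
  · intro u hu x hx
    refine ContinuousOn.aestronglyMeasurable (fun t ht => ?_) measurableSet_Ioc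
    have c1 : ContinuousAt (fun t => u (x * (1 + t))) t :=
      ContinuousAt.comp' (g := u) (hu.1.continuousOn.continuousAt (Ioi_mem_nhds
        (mul_pos hx (by linarith [ht.1])))) (by fun_prop)
    have c2 : ContinuousAt (fun t => u (x * (1 - t))) t :=
      ContinuousAt.comp' (g := u) (hu.1.continuousOn.continuousAt (Ioi_mem_nhds
        (mul_pos hx (by linarith [ht.2])))) (by fun_prop)
    exact (((continuousAt_const.sub c1).sub c2).mul
      (Real.continuousAt_rpow_const _ _ (Or.inl ht.1.ne'))).continuousWithinAt
  · have : IntegrableOn (fun t : ℝ => t ^ (1 - 2 * s)) (Ioc 0 (1 / 2)) := by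
      rw [← intervalIntegrable_iff_integrableOn_Ioc_of_le (by norm_num)]
      exact intervalIntegral.intervalIntegrable_rpow' (by linarith)
    exact this
  · filter_upwards [ae_restrict_mem measurableSet_Ioc] with t ht using Real.rpow_nonneg ht.1.le _
  · intro u hu
    obtain ⟨C, h0, hC⟩ := second_diff hu
    refine ⟨C, h0, ?_⟩
    filter_upwards [ae_restrict_mem measurableSet_Ioc] with t ht x hx
    rw [abs_mul, abs_of_nonneg (Real.rpow_nonneg ht.1.le _)]
    have := mul_le_mul_of_nonneg_right (hC t ht x hx) (Real.rpow_nonneg ht.1.le (-(1 + 2 * s)))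
    refine this.trans (le_of_eq ?_)
    rw [show 1 - 2 * s = 2 + -(1 + 2 * s) by ring, Real.rpow_add ht.1]
    norm_cast
    ring
  · intro u hu
    filter_upwards [ae_restrict_mem measurableSet_Ioc] with t ht x hx
    have d1 := theta_comp hu.1 (a := 1 + t) (by linarith [ht.1]) hx
    have d2 := theta_comp hu.1 (a := 1 - t) (by linarith [ht.2]) hx
    have d0 := theta_comp hu.1 (a := 1) (by norm_num) hx
    simp only [mul_one] at d0
    refine ((((d0.const_mul 2).sub d1).sub d2).mul_const (t ^ (-(1 + 2 * s)))).congr_deriv ?_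
    ring

theorem far_BB {γ : ℝ} {k : ℝ → ℝ} (hk : Measurable k)
    (hint : IntegrableOn (fun t => t ^ γ * k t) (Ioi 0)) (u : ℝ → ℝ) (hu : GB γ u) :
    (∀ x > 0, Integrable (fun t => u (x * t) * k t) (volume.restrict (Ioi 0))) ∧
    BB γ (fun x => ∫ t in Ioi 0, u (x * t) * k t) := by
  refine kernel_BB (S := GB γ) (μ := volume.restrict (Ioi 0))
    (W := fun u x t => u (x * t) * k t)
    (b := fun t => |t ^ γ * k t|) (fun u hu => hu.theta) ?_ hint.abs ?_ ?_ ?_ u hu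
  · intro u hu x hx
    refine AEStronglyMeasurable.mul ?_ hk.aestronglyMeasurable
    refine ContinuousOn.aestronglyMeasurable (fun t ht => ?_) measurableSet_Ioi
    exact (ContinuousAt.comp' (g := u) (hu.1.continuousOn.continuousAt (Ioi_mem_nhds
        (mul_pos hx ht))) (by fun_prop)).continuousWithinAt
  · exact Eventually.of_forall fun t => abs_nonneg _
  · intro u hu
    obtain ⟨C, h0, hC⟩ := hu.bound
    refine ⟨C, h0, ?_⟩
    filter_upwards [ae_restrict_mem measurableSet_Ioi] with t ht x hx
    have ht0 : 0 < t := ht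
    rw [abs_mul, abs_mul, abs_of_nonneg (Real.rpow_nonneg ht0.le _)]
    have := mul_le_mul_of_nonneg_right (hC (x * t) (mul_pos hx ht)) (abs_nonneg (k t))
    refine this.trans (le_of_eq ?_)
    rw [Real.mul_rpow hx.le ht0.le]; ring
  · intro u hu
    filter_upwards [ae_restrict_mem measurableSet_Ioi] with t ht x hx
    refine ((theta_comp hu.1 (a := t) ht hx).mul_const (k t)).congr_deriv ?_
    ring

end Ker

noncomputable section LapA

theorem bdd_int {p M c : ℝ} (hp : 1 < p) (hc : 0 < c) {v : ℝ → ℝ} (hv : Continuous v)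
    (hM : ∀ x, |v x| ≤ M) : IntegrableOn (fun t => v t * t ^ (-p)) (Ioi c) := by
  have h1 : IntegrableOn (fun t : ℝ => M * t ^ (-p)) (Ioi c) :=
    (integrableOn_Ioi_rpow_of_lt (by linarith) hc).const_mul _
  refine Integrable.mono' h1 ?_ ?_
  · exact (hv.measurable.mul (by fun_prop)).aestronglyMeasurable
  · filter_upwards [ae_restrict_mem measurableSet_Ioi] with t ht
    have ht0 : 0 < t := hc.trans ht
    rw [norm_mul, Real.norm_of_nonneg (Real.rpow_nonneg ht0.le _)]
    exact mul_le_mul_of_nonneg_right (hM t) (Real.rpow_nonneg ht0.le _)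

theorem far_eq {p x : ℝ} (hp : 1 < p) (hx : 0 < x) {u : ℝ → ℝ} (hu : Continuous u)
    (hM : ∃ M : ℝ, ∀ x, |u x| ≤ M) (hu0 : ∀ x ≤ 0, u x = 0) :
    (∫ t in Ioi (1 / 2 : ℝ), u (x * (1 + t)) * t ^ (-p)) +
      (∫ t in Ioi (1 / 2 : ℝ), u (x * (1 - t)) * t ^ (-p)) =
    ∫ τ in Ioi 0, u (x * τ) * kInd p τ := by
  obtain ⟨M, hM⟩ := hM
  set G : ℝ → ℝ := fun τ => u (x * τ) * kInd p τ with hG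
  have i1 : IntegrableOn (fun t => u (x * (1 + t)) * t ^ (-p)) (Ioi (1 / 2)) :=
    bdd_int hp (by norm_num) (v := fun t => u (x * (1 + t))) (by fun_prop) (fun _ => hM _)
  have i2 : IntegrableOn (fun t => u (x * (1 - t)) * t ^ (-p)) (Ioi (1 / 2)) :=
    bdd_int hp (by norm_num) (v := fun t => u (x * (1 - t))) (by fun_prop) (fun _ => hM _)
  have m1 : MeasurePreserving (fun h : ℝ => 1 + h) volume volume := measurePreserving_add_left volume 1
  have e1 : MeasurableEmbedding (fun h : ℝ => 1 + h) := measurableEmbedding_addLeft 1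
  have m2 : MeasurePreserving (fun h : ℝ => 1 - h) volume volume :=
    Measure.measurePreserving_sub_left volume 1
  have e2 : MeasurableEmbedding (fun h : ℝ => 1 - h) :=
    (MeasurableEquiv.subLeft 1).measurableEmbedding
  have p1 : (fun h : ℝ => 1 + h) ⁻¹' (Ioi (3 / 2)) = Ioi (1 / 2) := by
    ext h; simp only [mem_preimage, mem_Ioi]; constructor <;> intro <;> linarith
  have p2 : (fun h : ℝ => 1 - h) ⁻¹' (Iio (1 / 2)) = Ioi (1 / 2) := by
    ext h; simp only [mem_preimage, mem_Ioi, mem_Iio]; constructor <;> intro <;> linarith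
  have f1 : EqOn (fun t => u (x * (1 + t)) * t ^ (-p)) (G ∘ fun h : ℝ => 1 + h) (Ioi (1 / 2)) := by
    intro t ht
    have ht1 : 1 / 2 < t := ht
    have : |1 - (1 + t)| = t := by rw [show 1 - (1 + t) = -t by ring, abs_neg, abs_of_pos]; linarith
    simp only [hG, Function.comp, kInd, this, if_pos ht1]
  have f2 : EqOn (fun t => u (x * (1 - t)) * t ^ (-p)) (G ∘ fun h : ℝ => 1 - h) (Ioi (1 / 2)) := by
    intro t ht
    have ht1 : 1 / 2 < t := ht
    have : |1 - (1 - t)| = t := by rw [show 1 - (1 - t) = t by ring, abs_of_pos]; linarith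
    simp only [hG, Function.comp, kInd, this, if_pos ht1]
  have j1 : IntegrableOn G (Ioi (3 / 2)) := by
    rw [← m1.integrableOn_comp_preimage e1, p1]
    exact (integrableOn_congr_fun f1 measurableSet_Ioi).1 i1
  have j2 : IntegrableOn G (Iio (1 / 2)) := by
    rw [← m2.integrableOn_comp_preimage e2, p2]
    exact (integrableOn_congr_fun f2 measurableSet_Ioi).1 i2
  have k1 : ∫ y in Ioi (3 / 2), G y = ∫ t in Ioi (1 / 2 : ℝ), u (x * (1 + t)) * t ^ (-p) := by
    rw [← m1.setIntegral_preimage_emb e1, p1]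
    exact (setIntegral_congr_fun measurableSet_Ioi f1).symm
  have k2 : ∫ y in Iio (1 / 2), G y = ∫ t in Ioi (1 / 2 : ℝ), u (x * (1 - t)) * t ^ (-p) := by
    rw [← m2.setIntegral_preimage_emb e2, p2]
    exact (setIntegral_congr_fun measurableSet_Ioi f2).symm
  have hdisj : Disjoint (Iio (1 / 2 : ℝ)) (Ioi (3 / 2)) := by
    rw [Set.disjoint_left]
    intro y hy hy'
    simp only [mem_Iio, mem_Ioi] at hy hy'
    linarith
  rw [← k1, ← k2, add_comm, ← setIntegral_union hdisj measurableSet_Ioi j2 j1,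
    setIntegral_eq_integral_of_forall_compl_eq_zero, setIntegral_eq_integral_of_forall_compl_eq_zero]
  · intro τ hτ
    rw [hu0, zero_mul]
    simp only [mem_Ioi, not_lt] at hτ
    exact mul_nonpos_of_nonneg_of_nonpos hx.le hτ
  · intro τ hτ
    simp only [mem_union, mem_Iio, mem_Ioi, not_or, not_lt] at hτ
    rw [hG]; simp only [kInd]
    rw [if_neg, mul_zero]
    rw [not_lt, abs_le]
    constructor <;> linarith

theorem GB.bounded {γ : ℝ} {u : ℝ → ℝ} (h : GB γ u) (hγ : 0 < γ) (h0 : ∀ x ≤ 0, u x = 0) :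
    ∃ M : ℝ, ∀ x, |u x| ≤ M := by
  obtain ⟨M, hM⟩ := (isCompact_Icc (a := (0 : ℝ)) (b := 1)).exists_bound_of_continuousOn
      (h.1.continuous hγ h0).continuousOn
  have hM0 : 0 ≤ M := (norm_nonneg _).trans (hM 0 (by simp))
  refine ⟨M, fun x => ?_⟩
  by_cases hx : x ∈ Icc (0 : ℝ) 1
  · exact hM x hx
  · rcases le_or_gt x 0 with h1 | h1
    · rw [h0 x h1]; simpa
    · rw [h.2 x, abs_zero]; · exact hM0
      have : ¬ x ≤ 1 := fun h2 => hx ⟨h1.le, h2⟩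
      linarith

theorem lapA {s γ : ℝ} (hs0 : 0 < s) (hs1 : s < 1) (hγ : 0 < γ) {u : ℝ → ℝ} (hu : GB γ u)
    (hu0 : ∀ x ≤ 0, u x = 0) (hN : γ - 2 * s ≠ ⌈γ - 2 * s⌉₊) :
    ∃ P g : ℝ → ℝ, ContDiff ℝ (⊤ : ℕ∞) P ∧ BB (γ - 2 * s) g ∧
      ∀ x > 0, IntegrableOn (DD s u x) (Ioi 0) ∧ ∫ h in Ioi 0, DD s u x h = P x + g x := by
  set N := ⌈γ - 2 * s⌉₊ with hNdef
  have hcont := hu.1.continuous hγ hu0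
  have hM := hu.bounded hγ hu0
  have hN1 : γ - 2 * s < N := lt_of_le_of_ne (Nat.le_ceil _) hN
  have hN2 : ∀ n < N, (n : ℝ) < γ - 2 * s := fun n hn => Nat.lt_ceil.1 hn
  set p := 1 + 2 * s with hp
  have hp1 : 1 < p := by rw [hp]; linarith
  obtain ⟨b, hb⟩ := ker_integrable (p := p) (γ := γ) N hp1 (by linarith)
    (by rw [hp]; linarith) (fun n hn => by have := hN2 n hn; rw [hp]; linarith)
  set k : ℝ → ℝ := fun t => kInd p t - ∑ n ∈ Finset.range N, b n * t ^ (-p - n) with hk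
  have hkm : Measurable k := by
    have := kInd_meas p
    fun_prop
  obtain ⟨fi, fB⟩ := far_BB hkm hb u hu
  obtain ⟨ni, nB⟩ := near_BB (s := s) hs1 u hu
  rw [← hp] at ni nB
  set A : ℝ := ∫ t in Ioi (1 / 2 : ℝ), t ^ (-p) with hA
  set Mn : ℕ → ℝ := fun n => ∫ y in Ioi (0 : ℝ), u y * y ^ (-p - n) with hMn
  set near : ℝ → ℝ := fun x => ∫ t in Ioc 0 (1 / 2),
      (2 * u x - u (x * (1 + t)) - u (x * (1 - t))) * t ^ (-p) with hnear
  set far : ℝ → ℝ := fun x => ∫ t in Ioi 0, u (x * t) * k t with hfar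
  refine ⟨fun x => -∑ n ∈ Finset.range N, b n * Mn n * x ^ n,
    fun x => x ^ (-2 * s) * ((near x + 2 * A * u x) + (-1) * far x), ?_, ?_, ?_⟩
  · refine (ContDiff.sum fun n _ => ?_).neg
    exact contDiff_const.mul (contDiff_id.pow n)
  · have := (BB.rpow (-2 * s)).mul ((nB.add (hu.1.const_mul (2 * A))).add (fB.const_mul (-1)))
    rwa [show -2 * s + γ = γ - 2 * s by ring] at this
  intro x hx
  -- moments
  have mom : ∀ n < N, IntegrableOn (fun t => u (x * t) * t ^ (-p - n)) (Ioi 0) ∧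
      ∫ t in Ioi 0, u (x * t) * t ^ (-p - n) = x ^ (2 * s) * (Mn n * x ^ n) := by
    intro n hn
    have base : IntegrableOn (fun y => u y * y ^ (-p - n)) (Ioi 0) := by
      obtain ⟨C, h0, hC⟩ := hu.bound
      have hn' := hN2 n hn
      have i1 : IntegrableOn (fun y => u y * y ^ (-p - n)) (Ioc 0 1) := by
        have : IntegrableOn (fun y : ℝ => C * y ^ (γ + (-p - n))) (Ioc 0 1) := by
          rw [← intervalIntegrable_iff_integrableOn_Ioc_of_le (by norm_num)]
          exact (intervalIntegral.intervalIntegrable_rpow' (by rw [hp]; linarith)).const_mul _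
        refine Integrable.mono' this (hcont.measurable.mul (by fun_prop)).aestronglyMeasurable ?_
        filter_upwards [ae_restrict_mem measurableSet_Ioc] with y hy
        rw [norm_mul, Real.norm_of_nonneg (Real.rpow_nonneg hy.1.le _), Real.rpow_add hy.1,
          ← mul_assoc]
        exact mul_le_mul_of_nonneg_right (hC y hy.1) (Real.rpow_nonneg hy.1.le _)
      have i2 : IntegrableOn (fun y => u y * y ^ (-p - n)) (Ioi 1) := by
        refine (integrableOn_congr_fun (f := fun _ => (0 : ℝ)) (fun y hy => ?_)
          measurableSet_Ioi).1 integrableOn_zero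
        have hy' : 1 < y := hy
        simp only
        rw [hu.2 y (by linarith), zero_mul]
      rw [← Ioc_union_Ioi_eq_Ioi (show (0 : ℝ) ≤ 1 by norm_num)]
      exact i1.union i2
    have hE : EqOn (fun t => u (x * t) * t ^ (-p - n))
        (fun t => x ^ (p + n) * (fun y => u y * y ^ (-p - n)) (x * t)) (Ioi 0) := by
      intro t ht
      have ht0 : 0 < t := ht
      simp only
      rw [Real.mul_rpow hx.le ht0.le, show -p - n = -(p + n) by ring, Real.rpow_neg hx.le]
      have := (Real.rpow_pos_of_pos hx (p + n)).ne'
      field_simp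
    constructor
    · refine (integrableOn_congr_fun hE measurableSet_Ioi).2 (Integrable.const_mul ?_ _)
      have := (integrableOn_Ioi_comp_mul_left_iff (fun y => u y * y ^ (-p - n)) 0 hx).2
        (by rwa [mul_zero])
      exact this
    · rw [setIntegral_congr_fun measurableSet_Ioi hE, integral_const_mul,
        integral_comp_mul_left_Ioi (fun y => u y * y ^ (-p - n)) 0 hx, mul_zero, smul_eq_mul, hp,
        show 1 + 2 * s + (n : ℝ) = 1 + (2 * s + n) by ring, Real.rpow_add hx, Real.rpow_add hx,
        Real.rpow_one, Real.rpow_natCast]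
      have e : (∫ (y : ℝ) in Ioi 0, u y * y ^ (-(1 + 2 * s) - n)) = Mn n := by rw [hMn, hp]
      rw [e]; field_simp
  -- far identity
  have hfar_id : ∫ τ in Ioi 0, u (x * τ) * kInd p τ =
      far x + ∑ n ∈ Finset.range N, b n * (x ^ (2 * s) * (Mn n * x ^ n)) := by
    have hs1 : IntegrableOn (fun t => ∑ n ∈ Finset.range N, b n * (u (x * t) * t ^ (-p - n)))
        (Ioi 0) := integrable_finsetSum _ fun n hn =>
          ((mom n (Finset.mem_range.1 hn)).1.const_mul (b n))
    have hs2 : ∫ t in Ioi 0, ∑ n ∈ Finset.range N, b n * (u (x * t) * t ^ (-p - n)) =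
        ∑ n ∈ Finset.range N, b n * (x ^ (2 * s) * (Mn n * x ^ n)) := by
      rw [integral_finsetSum _ fun n hn => ((mom n (Finset.mem_range.1 hn)).1.const_mul (b n))]
      refine Finset.sum_congr rfl fun n hn => ?_
      rw [integral_const_mul, (mom n (Finset.mem_range.1 hn)).2]
    rw [← hs2, hfar]
    simp only
    rw [← integral_add (fi x hx) hs1]
    refine setIntegral_congr_fun measurableSet_Ioi fun t _ => ?_
    simp only [hk]
    rw [mul_sub, Finset.mul_sum]
    have : ∑ n ∈ Finset.range N, u (x * t) * (b n * t ^ (-p - n)) =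
        ∑ n ∈ Finset.range N, b n * (u (x * t) * t ^ (-p - n)) :=
      Finset.sum_congr rfl fun n _ => by ring
    rw [this]; ring
  -- the rescaled integrand
  set E : ℝ → ℝ := fun t => (2 * u x - u (x * (1 + t)) - u (x * (1 - t))) * t ^ (-p) with hE
  obtain ⟨M, hM'⟩ := hM
  have i1 : IntegrableOn (fun t => u (x * (1 + t)) * t ^ (-p)) (Ioi (1 / 2)) :=
    bdd_int hp1 (by norm_num) (v := fun t => u (x * (1 + t))) (by fun_prop) (fun _ => hM' _)
  have i2 : IntegrableOn (fun t => u (x * (1 - t)) * t ^ (-p)) (Ioi (1 / 2)) :=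
    bdd_int hp1 (by norm_num) (v := fun t => u (x * (1 - t))) (by fun_prop) (fun _ => hM' _)
  have i0 : IntegrableOn (fun t : ℝ => 2 * u x * t ^ (-p)) (Ioi (1 / 2)) :=
    (integrableOn_Ioi_rpow_of_lt (by linarith) (by norm_num)).const_mul _
  have hEeq : E = fun t => 2 * u x * t ^ (-p) - (u (x * (1 + t)) * t ^ (-p) +
      u (x * (1 - t)) * t ^ (-p)) := by
    funext t; simp only [hE]; ring
  have i12 : IntegrableOn (fun t => u (x * (1 + t)) * t ^ (-p) + u (x * (1 - t)) * t ^ (-p))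
    (Ioi (1 / 2)) := i1.add i2
  have iE2 : IntegrableOn E (Ioi (1 / 2)) := by rw [hEeq]; exact i0.sub i12
  have iE1 : IntegrableOn E (Ioc 0 (1 / 2)) := ni x hx
  have hun : Ioc (0 : ℝ) (1 / 2) ∪ Ioi (1 / 2) = Ioi 0 := Ioc_union_Ioi_eq_Ioi (by norm_num)
  have iE : IntegrableOn E (Ioi 0) := by rw [← hun]; exact iE1.union iE2
  have vE : ∫ t in Ioi 0, E t = near x + (2 * u x * A - (far x +
      ∑ n ∈ Finset.range N, b n * (x ^ (2 * s) * (Mn n * x ^ n)))) := by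
    rw [← hun, setIntegral_union (by
      rw [Set.disjoint_left]; intro y hy hy'; exact absurd hy.2 (not_le.2 hy')) measurableSet_Ioi
      iE1 iE2]
    congr 1
    rw [hEeq, integral_sub i0 i12, integral_const_mul, integral_add i1 i2,
      far_eq hp1 hx hcont ⟨M, hM'⟩ hu0, hfar_id]
  have hDE : EqOn (fun t => DD s u x (x * t)) (fun t => x ^ (-p) * E t) (Ioi 0) := by
    intro t ht
    have ht0 : 0 < t := ht
    simp only [DD, hE]
    rw [← hp, Real.mul_rpow hx.le ht0.le, Real.rpow_neg hx.le, Real.rpow_neg ht0.le,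
      show x * (1 + t) = x + x * t by ring, show x * (1 - t) = x - x * t by ring]
    have := (Real.rpow_pos_of_pos hx p).ne'
    have := (Real.rpow_pos_of_pos ht0 p).ne'
    field_simp
  constructor
  · have := (integrableOn_Ioi_comp_mul_left_iff (DD s u x) 0 hx).1
      ((integrableOn_congr_fun hDE measurableSet_Ioi).2 (Integrable.const_mul iE _))
    rwa [mul_zero] at this
  · have h1 := integral_comp_mul_left_Ioi (DD s u x) 0 hx
    rw [mul_zero, smul_eq_mul, setIntegral_congr_fun measurableSet_Ioi hDE, integral_const_mul,
      vE] at h1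
    have h2 : ∫ h in Ioi 0, DD s u x h = x * x ^ (-p) * (near x + (2 * u x * A - (far x +
      ∑ n ∈ Finset.range N, b n * (x ^ (2 * s) * (Mn n * x ^ n))))) := by
      rw [mul_assoc, h1]; field_simp
    have h3 : x * x ^ (-p) = x ^ (-2 * s) := by
      rw [hp, show -(1 + 2 * s) = -2 * s - 1 by ring, Real.rpow_sub_one hx.ne']; field_simp
    have h4 : ∑ n ∈ Finset.range N, b n * (x ^ (2 * s) * (Mn n * x ^ n)) =
        x ^ (2 * s) * ∑ n ∈ Finset.range N, b n * Mn n * x ^ n := by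
      rw [Finset.mul_sum]; exact Finset.sum_congr rfl fun n _ => by ring
    have h5 : x ^ (-2 * s) * x ^ (2 * s) = 1 := by
      rw [← Real.rpow_add hx]; simp
    rw [h2, h3, h4]
    simp only
    linear_combination (-(∑ n ∈ Finset.range N, b n * Mn n * x ^ n)) * h5

end LapA

noncomputable section Claim

/-- cutoff -/
def chi (x : ℝ) : ℝ := Real.smoothTransition (3 - 4 * x)

theorem chi_smooth : ContDiff ℝ (⊤ : ℕ∞) chi :=
  Real.smoothTransition.contDiff.comp (by fun_prop)

theorem inv2 {β : ℝ} {g : ℝ → ℝ} (h : BB β g) (hβ : -1 < β) :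
    ∃ v : ℝ → ℝ, GB (β + 2) v ∧ (∀ x ≤ 0, v x = 0) ∧
      ∀ x ∈ Ioo (0 : ℝ) (1 / 2), deriv (deriv v) x = g x := by
  have h1 := h.integral hβ
  set G1 : ℝ → ℝ := fun x => ∫ t in (0 : ℝ)..x, g t with hG1
  have h2 := h1.integral (by linarith)
  set G2 : ℝ → ℝ := fun x => ∫ t in (0 : ℝ)..x, G1 t with hG2
  refine ⟨fun x => if x ≤ 0 then 0 else chi x * G2 x, ⟨?_, ?_⟩, ?_, ?_⟩
  · have := (BB.smooth chi_smooth).mul h2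
    rw [show 0 + (β + 1 + 1) = β + 2 by ring] at this
    refine this.congr fun x hx => ?_
    rw [if_neg (not_le.2 hx)]
  · intro x hx
    beta_reduce; rw [if_neg (not_le.2 (by linarith)), chi, Real.smoothTransition.zero_of_nonpos (by linarith), zero_mul]
  · intro x hx
    beta_reduce; rw [if_pos hx]
  · intro x hx
    have hmem := Ioo_mem_nhds hx.1 hx.2
    have d1 : ∀ y ∈ Ioo (0 : ℝ) (1 / 2),
        deriv (fun x => if x ≤ 0 then 0 else chi x * G2 x) y = G1 y := by
      intro y hy
      rw [← (h1.hasDerivAt_integral (by linarith) hy.1).deriv]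
      apply Filter.EventuallyEq.deriv_eq
      filter_upwards [Ioo_mem_nhds hy.1 hy.2] with z hz
      rw [if_neg (not_le.2 hz.1), chi, Real.smoothTransition.one_of_one_le (by linarith [hz.2]),
        one_mul]
    rw [← (h.hasDerivAt_integral hβ hx.1).deriv]
    apply Filter.EventuallyEq.deriv_eq
    filter_upwards [hmem] with z hz using d1 z hz

theorem lapA' {s γ : ℝ} (hs0 : 0 < s) (hs1 : s < 1) (hγ : 1 < γ) {u : ℝ → ℝ} (hu : GB γ u)
    (hu0 : ∀ x ≤ 0, u x = 0) :
    ∃ P g : ℝ → ℝ, ContDiff ℝ (⊤ : ℕ∞) P ∧ BB (γ - 1 - s) g ∧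
      ∀ x > 0, IntegrableOn (DD s u x) (Ioi 0) ∧ ∫ h in Ioi 0, DD s u x h = P x + g x := by
  by_cases hN : γ - 2 * s = ⌈γ - 2 * s⌉₊
  · have hu' : GB (γ - (1 - s)) u := ⟨hu.1.mono (by linarith), hu.2⟩
    obtain ⟨P, g, hP, hg, h⟩ := lapA hs0 hs1 (by linarith) hu' hu0 (by
      intro h2
      set n := ⌈γ - 2 * s⌉₊
      set m := ⌈γ - (1 - s) - 2 * s⌉₊
      have h3 : (m : ℝ) < n := by rw [← hN, ← h2]; linarith
      have h4 : (n : ℝ) < m + 1 := by rw [← hN, ← h2]; linarith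
      norm_cast at h3 h4
      omega)
    exact ⟨P, g, hP, hg.mono (by linarith), h⟩
  · obtain ⟨P, g, hP, hg, h⟩ := lapA hs0 hs1 (by linarith) hu hu0 hN
    exact ⟨P, g, hP, hg.mono (by linarith), h⟩

theorem DD_add {s : ℝ} {u v : ℝ → ℝ} {x : ℝ} (hu : IntegrableOn (DD s u x) (Ioi 0))
    (hv : IntegrableOn (DD s v x) (Ioi 0)) :
    IntegrableOn (DD s (fun x => u x + v x) x) (Ioi 0) ∧
      ∫ h in Ioi 0, DD s (fun x => u x + v x) x h =
        (∫ h in Ioi 0, DD s u x h) + ∫ h in Ioi 0, DD s v x h := by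
  have : DD s (fun x => u x + v x) x = fun h => DD s u x h + DD s v x h := by
    funext h; simp only [DD]; ring
  rw [this]
  exact ⟨hu.add hv, integral_add hu hv⟩

theorem deriv2_add {u v : ℝ → ℝ} {γ δ : ℝ} (hu : BB γ u) (hv : BB δ v) {x : ℝ} (hx : 0 < x) :
    deriv (deriv (fun x => u x + v x)) x = deriv (deriv u) x + deriv (deriv v) x := by
  rw [← deriv_fun_add (diffAt_of hu.deriv.diff hx) (diffAt_of hv.deriv.diff hx)]
  apply deriv_congr_Ioi _ hx
  intro y hy
  exact deriv_fun_add (diffAt_of hu.diff hy) (diffAt_of hv.diff hy)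

theorem claim {s : ℝ} (hs0 : 0 < s) (hs1 : s < 1) (k n : ℕ) (β : ℝ) (hβ : -1 < β)
    (hk : k < β + (1 - s) + n * (1 - s)) (g : ℝ → ℝ) (hg : BB β g) :
    ∃ v f e : ℝ → ℝ, GB (β + 2) v ∧ (∀ x ≤ 0, v x = 0) ∧
      ContDiffOn ℝ k f (Icc 0 (1 / 2)) ∧
      (∀ x ∈ Ioo (0 : ℝ) (1 / 2), IntegrableOn (DD s v x) (Ioi 0) ∧
        fracConst s * ∫ h in Ioi 0, DD s v x h = f x - g x + deriv (deriv v) x) ∧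
      BB (β + (1 - s)) e ∧ ∀ x ∈ Ioo (0 : ℝ) (1 / 2), deriv (deriv v) x = g x + e x := by
  induction n generalizing β g with
  | zero =>
    obtain ⟨v, hv, hv0, hvg⟩ := inv2 hg hβ
    obtain ⟨P, g', hP, hg', hL⟩ := lapA' hs0 hs1 (by linarith) hv hv0
    rw [show β + 2 - 1 - s = β + (1 - s) by ring] at hg'
    have hc : ContDiff ℝ k (fun x => if x ≤ 0 then 0 else fracConst s * g' x) := by
      refine BB.contDiff (γ := β + (1 - s)) k ?_ (by simpa using hk) (fun x hx => if_pos hx)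
      exact (hg'.const_mul (fracConst s)).congr fun x hx => (if_neg (not_le.2 hx)).symm
    have hPk : ContDiff ℝ k P := hP.of_le (by exact_mod_cast le_top)
    refine ⟨v, fun x => fracConst s * P x + if x ≤ 0 then 0 else fracConst s * g' x, fun _ => 0,
      hv, hv0, ((contDiff_const.mul hPk).add hc).contDiffOn, ?_, ?_, ?_⟩
    · intro x hx
      refine ⟨(hL x hx.1).1, ?_⟩
      beta_reduce; rw [(hL x hx.1).2, hvg x hx, if_neg (not_le.2 hx.1)]
      ring
    · have := (BB.rpow (β + (1 - s))).const_mul 0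
      simpa using this
    · intro x hx
      beta_reduce; rw [hvg x hx, add_zero]
  | succ n ih =>
    obtain ⟨v, hv, hv0, hvg⟩ := inv2 hg hβ
    obtain ⟨P, g', hP, hg', hL⟩ := lapA' hs0 hs1 (by linarith) hv hv0
    rw [show β + 2 - 1 - s = β + (1 - s) by ring] at hg'
    obtain ⟨v2, f2, e2, hv2, hv20, hf2, hL2, -, -⟩ := ih (β + (1 - s)) (by linarith)
      (by push_cast at hk; linarith) _ (hg'.const_mul (fracConst s))
    have hPk : ContDiff ℝ k P := hP.of_le (by exact_mod_cast le_top)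
    refine ⟨fun x => v x + v2 x, fun x => fracConst s * P x + f2 x, deriv (deriv v2),
      ⟨hv.1.add (hv2.1.mono (by linarith)), fun x hx => ?_⟩, fun x hx => ?_,
      (contDiff_const.mul hPk).contDiffOn.add hf2, fun x hx => ?_, ?_, fun x hx => ?_⟩
    · beta_reduce; rw [hv.2 x hx, hv2.2 x hx, add_zero]
    · beta_reduce; rw [hv0 x hx, hv20 x hx, add_zero]
    · obtain ⟨i1, e1⟩ := hL x hx.1
      obtain ⟨i2, e2⟩ := hL2 x hx
      obtain ⟨i3, e3⟩ := DD_add i1 i2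
      refine ⟨i3, ?_⟩
      rw [e3, mul_add, e2, e1, deriv2_add hv.1 hv2.1 hx.1, hvg x hx]
      ring
    · exact hv2.1.deriv.deriv.mono (by linarith)
    · rw [deriv2_add hv.1 hv2.1 hx.1, hvg x hx]

end Claim

noncomputable section Explicit

/-- clamp -/
def clampU (x : ℝ) : ℝ := max 0 (min x 1)

theorem clampU_cont : Continuous clampU := by unfold clampU; fun_prop

theorem clampU_bd (x : ℝ) : |clampU x| ≤ 1 := by
  unfold clampU
  rw [abs_of_nonneg (le_max_left _ _)]
  exact max_le (by norm_num) (min_le_right _ _)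

theorem clampU_zero {x : ℝ} (hx : x ≤ 0) : clampU x = 0 := by
  unfold clampU
  rw [min_eq_left (by linarith), max_eq_left hx]

theorem clampU_id {x : ℝ} (hx : 0 ≤ x) (hx1 : x ≤ 1) : clampU x = x := by
  unfold clampU
  rw [min_eq_left hx1, max_eq_right hx]

theorem clampU_one {x : ℝ} (hx : 1 ≤ x) : clampU x = 1 := by
  unfold clampU
  rw [min_eq_right hx, max_eq_right (by norm_num)]

theorem clamp_lap {s x : ℝ} (hs0 : 0 < s) (hx0 : 0 < x) (hx1 : x < 1 / 2) :
    IntegrableOn (DD s clampU x) (Ioi 0) ∧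
      ∫ h in Ioi 0, DD s clampU x h =
        (x ^ (1 - 2 * s) - (1 - x) ^ (1 - 2 * s)) / (2 * s) -
          ∫ h in x..(1 - x), h ^ (-(2 * s)) := by
  have hx1' : 0 < 1 - x := by linarith
  have hxx : x ≤ 1 - x := by linarith
  have hn0 : (0 : ℝ) ∉ uIcc x (1 - x) := by
    rw [uIcc_of_le hxx]; intro h; linarith [h.1]
  have ux : clampU x = x := clampU_id hx0.le (by linarith)
  have e1 : EqOn (DD s clampU x) (fun _ => 0) (Ioc 0 x) := by
    intro h hh
    simp only [DD]
    rw [ux, clampU_id (by linarith [hh.1]) (by linarith [hh.2]),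
      clampU_id (by linarith [hh.2]) (by linarith [hh.1])]
    ring
  have e2 : EqOn (DD s clampU x) (fun h => x * h ^ (-1 - 2 * s) - h ^ (-(2 * s)))
      (Ioc x (1 - x)) := by
    intro h hh
    have hp : 0 < h := hx0.trans hh.1
    have hk : h ^ (-(2 * s)) = h * (h ^ (1 + 2 * s))⁻¹ := by
      rw [show -(2 * s) = 1 + -(1 + 2 * s) by ring, Real.rpow_add hp, Real.rpow_neg hp.le,
        Real.rpow_one]
    simp only [DD]
    rw [ux, clampU_id (by linarith [hh.1]) (by linarith [hh.2]), clampU_zero (by linarith [hh.1]),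
      show -1 - 2 * s = -(1 + 2 * s) by ring, hk, Real.rpow_neg hp.le]
    ring
  have e3 : EqOn (DD s clampU x) (fun h => (2 * x - 1) * h ^ (-1 - 2 * s)) (Ioi (1 - x)) := by
    intro h hh
    have hh' : 1 - x < h := hh
    have hp : 0 < h := hx1'.trans hh
    simp only [DD]
    rw [ux, clampU_one (by linarith), clampU_zero (by linarith),
      show -1 - 2 * s = -(1 + 2 * s) by ring, Real.rpow_neg hp.le]
    ring
  have ii1 : IntervalIntegrable (fun h : ℝ => x * h ^ (-1 - 2 * s)) volume x (1 - x) :=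
    (intervalIntegral.intervalIntegrable_rpow (Or.inr hn0)).const_mul x
  have ii2 : IntervalIntegrable (fun h : ℝ => h ^ (-(2 * s))) volume x (1 - x) :=
    intervalIntegral.intervalIntegrable_rpow (Or.inr hn0)
  have i1 : IntegrableOn (DD s clampU x) (Ioc 0 x) :=
    (integrableOn_congr_fun e1 measurableSet_Ioc).2 integrableOn_zero
  have i2 : IntegrableOn (DD s clampU x) (Ioc x (1 - x)) :=
    (integrableOn_congr_fun e2 measurableSet_Ioc).2
      ((intervalIntegrable_iff_integrableOn_Ioc_of_le hxx).1 (ii1.sub ii2))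
  have i3 : IntegrableOn (DD s clampU x) (Ioi (1 - x)) :=
    (integrableOn_congr_fun e3 measurableSet_Ioi).2
      ((integrableOn_Ioi_rpow_of_lt (by linarith) hx1').const_mul _)
  have i23 : IntegrableOn (DD s clampU x) (Ioi x) := by
    rw [← Ioc_union_Ioi_eq_Ioi hxx]; exact i2.union i3
  have d : Disjoint (Ioc x (1 - x)) (Ioi (1 - x)) := Ioc_disjoint_Ioi le_rfl
  have d' : Disjoint (Ioc 0 x) (Ioi x) := Ioc_disjoint_Ioi le_rfl
  have hk : ∀ {y : ℝ}, 0 < y → y ^ (1 - 2 * s) = y * y ^ (-(2 * s)) := by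
    intro y hy
    rw [show (1 : ℝ) - 2 * s = 1 + -(2 * s) by ring, Real.rpow_add hy, Real.rpow_one]
  constructor
  · rw [← Ioc_union_Ioi_eq_Ioi hx0.le]; exact i1.union i23
  rw [← Ioc_union_Ioi_eq_Ioi hx0.le, setIntegral_union d' measurableSet_Ioi i1 i23,
    ← Ioc_union_Ioi_eq_Ioi hxx, setIntegral_union d measurableSet_Ioi i2 i3,
    setIntegral_congr_fun measurableSet_Ioc e1, setIntegral_congr_fun measurableSet_Ioc e2,
    setIntegral_congr_fun measurableSet_Ioi e3, ← intervalIntegral.integral_of_le hxx,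
    intervalIntegral.integral_sub ii1 ii2, intervalIntegral.integral_const_mul,
    integral_const_mul, integral_Ioi_rpow_of_lt (by linarith) hx1',
    integral_rpow (Or.inr ⟨by linarith, hn0⟩), integral_zero,
    hk hx0, hk hx1', show (-1 : ℝ) - 2 * s + 1 = -(2 * s) by ring]
  generalize x ^ (-(2 * s)) = X
  generalize (1 - x) ^ (-(2 * s)) = Y
  generalize (∫ h in x..(1 - x), h ^ (-(2 * s))) = J
  field_simp
  ring

theorem clamp_lap_ne {s x : ℝ} (hs0 : 0 < s) (hs : s ≠ 1 / 2) (hx0 : 0 < x) (hx1 : x < 1 / 2) :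
    ∫ h in Ioi 0, DD s clampU x h =
      1 / (2 * s * (1 - 2 * s)) * x ^ (1 - 2 * s) +
        -(1 / (2 * s * (1 - 2 * s))) * (1 - x) ^ (1 - 2 * s) := by
  have hn0 : (0 : ℝ) ∉ uIcc x (1 - x) := by
    rw [uIcc_of_le (by linarith)]; intro h; linarith [h.1]
  have h1 : 1 - 2 * s ≠ 0 := fun h => hs (by linarith)
  rw [(clamp_lap hs0 hx0 hx1).2, integral_rpow (Or.inr ⟨fun h => hs (by linarith), hn0⟩),
    show -(2 * s) + 1 = 1 - 2 * s by ring]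
  field_simp
  ring

theorem clamp_lap_half {x : ℝ} (hx0 : 0 < x) (hx1 : x < 1 / 2) :
    ∫ h in Ioi 0, DD (1 / 2) clampU x h = Real.log x + -Real.log (1 - x) := by
  rw [(clamp_lap (by norm_num) hx0 hx1).2]
  have : ∀ h : ℝ, h ^ (-(2 * (1 / 2 : ℝ))) = h⁻¹ := by
    intro h; rw [show -(2 * (1 / 2 : ℝ)) = -1 by norm_num, Real.rpow_neg_one]
  simp only [this]
  rw [integral_inv_of_pos hx0 (by linarith), Real.log_div (by linarith) (by linarith)]
  norm_num
  ring

theorem fracConst_pos {s : ℝ} (hs0 : 0 < s) (hs1 : s < 1) : 0 < fracConst s := by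
  unfold fracConst
  have h1 := Real.Gamma_pos_of_pos (show 0 < (1 + 2 * s) / 2 by linarith)
  have h2 := Real.Gamma_pos_of_pos (show 0 < 2 - s by linarith)
  have h3 : 0 < 1 - s := by linarith
  positivity

theorem construct {s : ℝ} (hs0 : 0 < s) (hs1 : s < 1) (k : ℕ) {β : ℝ} (hβ : -1 < β)
    {g p : ℝ → ℝ} (hg : BB β g) (hp : ContDiffOn ℝ k p (Icc 0 (1 / 2)))
    (hgp : ∀ x ∈ Ioo (0 : ℝ) (1 / 2), fracConst s * ∫ h in Ioi 0, DD s clampU x h = g x + p x) :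
    ∃ f u v e : ℝ → ℝ, (
      ContDiffOn ℝ k f (Icc (0 : ℝ) (1 / 2)) ∧
      (∃ M : ℝ, ∀ x, |u x| ≤ M) ∧ Continuous u ∧
      ContDiffOn ℝ (⊤ : ℕ∞) u (Ioo (0 : ℝ) 1) ∧
      (∀ x ≤ (0 : ℝ), u x = 0) ∧
      (∀ x ∈ Ioo (0 : ℝ) (1 / 2), HasFracLap s u x (f x + deriv (deriv u) x))) ∧
      EqOn u (fun x => x + v x) (Icc 0 (1 / 2)) ∧ BB (β + 2) v ∧ (∀ x ≤ 0, v x = 0) ∧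
      BB (β + (1 - s)) e ∧ ∀ x ∈ Ioo (0 : ℝ) (1 / 2), deriv (deriv v) x = g x + e x := by
  obtain ⟨n, hn⟩ := exists_nat_gt ((k - (β + (1 - s))) / (1 - s))
  rw [div_lt_iff₀ (by linarith)] at hn
  obtain ⟨v, f, e, hv, hv0, hf, hL, he, hve⟩ := claim hs0 hs1 k n β hβ (by linarith) g hg
  have hvc : Continuous v := hv.1.continuous (by linarith) hv0
  obtain ⟨M, hM⟩ := hv.bounded (by linarith) hv0
  have hb : ∀ x, |clampU x + v x| ≤ 1 + M := fun x =>
    (abs_add_le _ _).trans (add_le_add (clampU_bd x) (hM x))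
  have hc : Continuous (fun x => clampU x + v x) := clampU_cont.add hvc
  have heq : ∀ x ∈ Ioo (0 : ℝ) 1, clampU x + v x = x + v x := fun x hx => by
    rw [clampU_id hx.1.le hx.2.le]
  refine ⟨fun x => f x + p x, fun x => clampU x + v x, v, e, ⟨hf.add hp, ⟨1 + M, hb⟩, hc, ?_, ?_, ?_⟩,
    ?_, hv.1, hv0, he, hve⟩
  · refine ContDiffOn.congr ?_ heq
    exact contDiff_id.contDiffOn.add (hv.1.contDiffOn.mono fun x hx => mem_Ioi.2 hx.1)
  · intro x hx
    beta_reduce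
    rw [clampU_zero hx, hv0 x hx, add_zero]
  · intro x hx
    obtain ⟨i1, e1⟩ := hL x hx
    obtain ⟨i2, e2⟩ := DD_add (clamp_lap hs0 hx.1 hx.2).1 i1
    have := hasFracLap_of hs0 hc ⟨_, hb⟩ i2
    convert this using 1
    rw [e2, mul_add, e1, hgp x hx]
    have d1 : ∀ y ∈ Ioo (0 : ℝ) (1 / 2), deriv (fun x => clampU x + v x) y = 1 + deriv v y := by
      intro y hy
      have : HasDerivAt (fun x => x + v x) (1 + deriv v y) y :=
        (hasDerivAt_id y).add (diffAt_of hv.1.diff hy.1).hasDerivAt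
      rw [← this.deriv]
      apply Filter.EventuallyEq.deriv_eq
      filter_upwards [Ioo_mem_nhds hy.1 hy.2] with z hz
      exact heq z ⟨hz.1, by linarith [hz.2]⟩
    have d2 : deriv (deriv (fun x => clampU x + v x)) x = deriv (deriv v) x := by
      have : deriv (fun y => 1 + deriv v y) x = deriv (deriv v) x := by simp
      rw [← this]
      apply Filter.EventuallyEq.deriv_eq
      filter_upwards [Ioo_mem_nhds hx.1 hx.2] with z hz using d1 z hz
    rw [d2]
    ring
  · intro x hx
    beta_reduce
    rw [clampU_id hx.1 (by linarith [hx.2])]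

/-- first-order expansion of `v'` -/
theorem deriv_expand {β δ : ℝ} (hβ : -1 < β) (hδ : -1 < δ) {g e v : ℝ → ℝ} (hg : BB β g)
    (he : BB δ e) (hv : BB (β + 2) v) (hv0 : ∀ x ≤ 0, v x = 0)
    (h : ∀ x ∈ Ioo (0 : ℝ) (1 / 2), deriv (deriv v) x = g x + e x)
    {x : ℝ} (hx : x ∈ Ioo (0 : ℝ) (1 / 2)) :
    deriv v x = (∫ t in (0 : ℝ)..x, g t) + ∫ t in (0 : ℝ)..x, e t := by
  have hdv : BB (β + 1) (deriv v) := hv.deriv.mono (by linarith)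
  have z1 : Continuous (deriv v) := hdv.continuous (by linarith) (hv.deriv_left (by linarith) hv0)
  have ext : ∀ {γ : ℝ} {w : ℝ → ℝ}, -1 < γ → BB γ w →
      Continuous (fun x => if x ≤ 0 then 0 else ∫ t in (0 : ℝ)..x, w t) := by
    intro γ w hγ hw
    refine BB.continuous (γ := γ + 1) ?_ (by linarith) (fun x hx => if_pos hx)
    exact (hw.integral hγ).congr fun x hx => (if_neg (not_le.2 hx)).symm
  have c1 := ext hβ hg
  have c2 := ext hδ he
  have hD : ∀ y ∈ Ioo (0 : ℝ) (1 / 2), HasDerivAt (fun x => deriv v x -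
      (if x ≤ 0 then 0 else ∫ t in (0 : ℝ)..x, g t) -
      (if x ≤ 0 then 0 else ∫ t in (0 : ℝ)..x, e t)) 0 y := by
    intro y hy
    have h1 := (diffAt_of hdv.diff hy.1).hasDerivAt
    have h2 := hg.hasDerivAt_integral hβ hy.1
    have h3 := he.hasDerivAt_integral hδ hy.1
    have h4 := (h1.sub h2).sub h3
    rw [h y hy, show g y + e y - g y - e y = 0 by ring] at h4
    refine h4.congr_of_eventuallyEq ?_
    filter_upwards [Ioi_mem_nhds hy.1] with z hz
    have hz' : ¬ z ≤ 0 := not_le.2 hz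
    simp [hz']
  obtain ⟨c, hc, hc2⟩ := exists_deriv_eq_slope _ hx.1
    (((z1.sub c1).sub c2).continuousOn) (fun y hy =>
      (hD y ⟨hy.1, hy.2.trans hx.2⟩).differentiableAt.differentiableWithinAt)
  have hcd := (hD c ⟨hc.1, hc.2.trans hx.2⟩).deriv
  have hv'0 := hv.deriv_left (by linarith) hv0 0 le_rfl
  have hz' : ¬ x ≤ 0 := not_le.2 hx.1
  replace hc2 := hcd.symm.trans hc2
  rw [eq_comm, div_eq_zero_iff] at hc2
  rcases hc2 with hc2 | hc2
  · simp only [Pi.sub_apply, if_neg hz', le_refl, if_true, hv'0] at hc2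
    linarith
  · linarith [hx.1]

end Explicit

noncomputable section Final

theorem holder1_iff {u v : ℝ → ℝ} {b : ℝ} (hu : EqOn u (fun x => x + v x) (Icc 0 (1 / 2)))
    (hv : ContDiff ℝ 1 v) :
    HolderIcc 1 b u ↔ ∃ C : ℝ, ∀ x ∈ Icc (0 : ℝ) (1 / 2), ∀ y ∈ Icc (0 : ℝ) (1 / 2),
      |deriv v x - deriv v y| ≤ C * |x - y| ^ b := by
  have hU : UniqueDiffOn ℝ (Icc (0 : ℝ) (1 / 2)) := uniqueDiffOn_Icc (by norm_num)
  have hw : ContDiff ℝ 1 (fun x => x + v x) := contDiff_id.add hv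
  have key : ∀ x ∈ Icc (0 : ℝ) (1 / 2),
      iteratedDerivWithin 1 u (Icc (0 : ℝ) (1 / 2)) x = 1 + deriv v x := by
    intro x hx
    rw [iteratedDerivWithin_congr hu hx,
      iteratedDerivWithin_eq_iteratedDeriv hU (by exact_mod_cast hw.contDiffAt) hx, iteratedDeriv_one]
    exact ((hasDerivAt_id x).add
      (hv.differentiable (by norm_num) x).hasDerivAt).deriv
  unfold HolderIcc
  constructor
  · rintro ⟨-, C, hC⟩
    refine ⟨C, fun x hx y hy => ?_⟩
    have := hC x hx y hy
    rwa [key x hx, key y hy, add_sub_add_left_eq_sub] at this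
  · rintro ⟨C, hC⟩
    refine ⟨by exact_mod_cast hw.contDiffOn.congr hu, C, fun x hx y hy => ?_⟩
    rw [key x hx, key y hy, add_sub_add_left_eq_sub]
    exact hC x hx y hy

theorem holder2_iff {u v : ℝ → ℝ} {b : ℝ} (hu : EqOn u (fun x => x + v x) (Icc 0 (1 / 2)))
    (hv : ContDiff ℝ 2 v) :
    HolderIcc 2 b u ↔ ∃ C : ℝ, ∀ x ∈ Icc (0 : ℝ) (1 / 2), ∀ y ∈ Icc (0 : ℝ) (1 / 2),
      |deriv (deriv v) x - deriv (deriv v) y| ≤ C * |x - y| ^ b := by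
  have hU : UniqueDiffOn ℝ (Icc (0 : ℝ) (1 / 2)) := uniqueDiffOn_Icc (by norm_num)
  have hw : ContDiff ℝ 2 (fun x => x + v x) := contDiff_id.add hv
  have key : ∀ x ∈ Icc (0 : ℝ) (1 / 2),
      iteratedDerivWithin 2 u (Icc (0 : ℝ) (1 / 2)) x = deriv (deriv v) x := by
    intro x hx
    rw [iteratedDerivWithin_congr hu hx,
      iteratedDerivWithin_eq_iteratedDeriv hU (by exact_mod_cast hw.contDiffAt) hx,
      iteratedDeriv_succ, iteratedDeriv_one]
    have : deriv (fun x => x + v x) = fun x => 1 + deriv v x := by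
      funext x
      exact ((hasDerivAt_id x).add (hv.differentiable (by norm_num) x).hasDerivAt).deriv
    rw [this]
    simp
  unfold HolderIcc
  constructor
  · rintro ⟨-, C, hC⟩
    refine ⟨C, fun x hx y hy => ?_⟩
    have := hC x hx y hy
    rwa [key x hx, key y hy] at this
  · rintro ⟨C, hC⟩
    refine ⟨by exact_mod_cast hw.contDiffOn.congr hu, C, fun x hx y hy => ?_⟩
    rw [key x hx, key y hy]
    exact hC x hx y hy

theorem sharp_rpow {w E : ℝ → ℝ} {b c d ε : ℝ} (hc : c ≠ 0) (hd : 0 < d) (hε : 0 < ε)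
    (hw0 : w 0 = 0) (hE : BB (b + d) E)
    (hw : ∀ x ∈ Ioo (0 : ℝ) (1 / 2), w x = c * x ^ b + E x)
    (hH : ∃ C : ℝ, ∀ x ∈ Icc (0 : ℝ) (1 / 2), ∀ y ∈ Icc (0 : ℝ) (1 / 2),
      |w x - w y| ≤ C * |x - y| ^ (b + ε)) : False := by
  obtain ⟨C, hC⟩ := hH
  obtain ⟨C', -, hC'⟩ := hE.bound
  have hb : ∀ x ∈ Ioo (0 : ℝ) (1 / 2), |c| ≤ C * x ^ ε + C' * x ^ d := by
    intro x hx
    have hx0 := hx.1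
    have h1 := hC x ⟨hx0.le, hx.2.le⟩ 0 ⟨le_rfl, by norm_num⟩
    rw [hw0, sub_zero, sub_zero, abs_of_pos hx0, hw x hx, Real.rpow_add hx0] at h1
    have h2 := hC' x ⟨hx0, by linarith [hx.2]⟩
    rw [Real.rpow_add hx0] at h2
    have hp := Real.rpow_pos_of_pos hx0 b
    have h3 : |c| * x ^ b ≤ |c * x ^ b + E x| + |E x| := by
      have := abs_sub (c * x ^ b + E x) (E x)
      rwa [add_sub_cancel_right, abs_mul, abs_of_pos hp] at this
    have h4 : |c| * x ^ b ≤ (C * x ^ ε + C' * x ^ d) * x ^ b := by nlinarith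
    exact le_of_mul_le_mul_right h4 hp
  have ht : ∀ {a : ℝ}, 0 < a → Tendsto (fun x : ℝ => x ^ a) (𝓝[>] 0) (𝓝 0) := by
    intro a ha
    have := (Real.continuousAt_rpow_const 0 a (Or.inr ha.le)).tendsto
    rw [Real.zero_rpow ha.ne'] at this
    exact this.mono_left nhdsWithin_le_nhds
  have hT := ((ht hε).const_mul C).add ((ht hd).const_mul C')
  have := ge_of_tendsto hT (by
    filter_upwards [Ioo_mem_nhdsGT (show (0 : ℝ) < 1 / 2 by norm_num)] with x hx using hb x hx)
  simp only [mul_zero, add_zero] at this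
  exact hc (abs_nonpos_iff.1 this)

theorem sharp_log {w E : ℝ → ℝ} {c d : ℝ} (hc : c ≠ 0) (hd : 0 < d)
    (hw0 : w 0 = 0) (hE : BB (1 + d) E)
    (hw : ∀ x ∈ Ioo (0 : ℝ) (1 / 2), w x = c * (x * Real.log x - x) + E x)
    (hH : ∃ C : ℝ, ∀ x ∈ Icc (0 : ℝ) (1 / 2), ∀ y ∈ Icc (0 : ℝ) (1 / 2),
      |w x - w y| ≤ C * |x - y| ^ (1 : ℝ)) : False := by
  obtain ⟨C, hC⟩ := hH
  obtain ⟨C', hC'0, hC'⟩ := hE.bound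
  have hb : ∀ x ∈ Ioo (0 : ℝ) (1 / 2), |c| * |Real.log x - 1| ≤ C + C' := by
    intro x hx
    have hx0 := hx.1
    have h1 := hC x ⟨hx0.le, hx.2.le⟩ 0 ⟨le_rfl, by norm_num⟩
    rw [hw0, sub_zero, sub_zero, abs_of_pos hx0, hw x hx, Real.rpow_one] at h1
    have h2 := hC' x ⟨hx0, by linarith [hx.2]⟩
    rw [Real.rpow_add hx0, Real.rpow_one] at h2
    have h5 : x ^ d ≤ 1 := Real.rpow_le_one hx0.le (by linarith [hx.2]) hd.le
    have h6 : |E x| ≤ C' * x := h2.trans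
      (mul_le_mul_of_nonneg_left (by nlinarith) hC'0)
    have h3 : |c| * |Real.log x - 1| * x ≤ |c * (x * Real.log x - x) + E x| + |E x| := by
      have := abs_sub (c * (x * Real.log x - x) + E x) (E x)
      rw [add_sub_cancel_right, show x * Real.log x - x = (Real.log x - 1) * x by ring, abs_mul,
        abs_mul, abs_of_pos hx0] at this
      rw [show x * Real.log x - x = (Real.log x - 1) * x by ring, mul_assoc]
      exact this
    have h4 : |c| * |Real.log x - 1| * x ≤ (C + C') * x := by nlinarith
    exact le_of_mul_le_mul_right h4 hx0
  have hcp := abs_pos.2 hc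
  have hev := (Real.tendsto_log_nhdsGT_zero.eventually (eventually_lt_atBot
    (1 - (C + C') / |c|))).and (Ioo_mem_nhdsGT (show (0 : ℝ) < 1 / 2 by norm_num))
  obtain ⟨x, h1, h2⟩ := hev.exists
  have h3 := hb x h2
  rw [mul_comm, ← le_div_iff₀ hcp] at h3
  have := neg_abs_le (Real.log x - 1)
  linarith

theorem case_ne {s : ℝ} (hs0 : 0 < s) (hs1 : s < 1) (hs : s ≠ 1 / 2) (k : ℕ) :
    ∃ c : ℝ, c ≠ 0 ∧ ∃ f u v e : ℝ → ℝ, (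
      ContDiffOn ℝ k f (Icc (0 : ℝ) (1 / 2)) ∧
      (∃ M : ℝ, ∀ x, |u x| ≤ M) ∧ Continuous u ∧
      ContDiffOn ℝ (⊤ : ℕ∞) u (Ioo (0 : ℝ) 1) ∧
      (∀ x ≤ (0 : ℝ), u x = 0) ∧
      (∀ x ∈ Ioo (0 : ℝ) (1 / 2), HasFracLap s u x (f x + deriv (deriv u) x))) ∧
      EqOn u (fun x => x + v x) (Icc 0 (1 / 2)) ∧ BB (1 - 2 * s + 2) v ∧ (∀ x ≤ 0, v x = 0) ∧
      BB (1 - 2 * s + (1 - s)) e ∧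
      ∀ x ∈ Ioo (0 : ℝ) (1 / 2), deriv (deriv v) x = c * x ^ (1 - 2 * s) + e x := by
  have hκ := fracConst_pos hs0 hs1
  set A := 1 / (2 * s * (1 - 2 * s)) with hA
  have h1 : 1 - 2 * s ≠ 0 := fun h => hs (by linarith)
  have hA0 : A ≠ 0 := by rw [hA]; positivity
  refine ⟨fracConst s * A, mul_ne_zero hκ.ne' hA0, ?_⟩
  refine construct (p := fun x => fracConst s * -A * (1 - x) ^ (1 - 2 * s)) hs0 hs1 k (by linarith)
    ((BB.rpow (1 - 2 * s)).const_mul _) ?_ ?_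
  · refine contDiffOn_const.mul (ContDiffOn.rpow_const_of_ne (by fun_prop) fun x hx => ?_)
    have := hx.2
    exact ne_of_gt (by linarith)
  · intro x hx
    rw [clamp_lap_ne hs0 hs hx.1 hx.2, ← hA]
    ring

theorem case_half (k : ℕ) :
    ∃ c : ℝ, c ≠ 0 ∧ ∃ f u v e : ℝ → ℝ, (
      ContDiffOn ℝ k f (Icc (0 : ℝ) (1 / 2)) ∧
      (∃ M : ℝ, ∀ x, |u x| ≤ M) ∧ Continuous u ∧
      ContDiffOn ℝ (⊤ : ℕ∞) u (Ioo (0 : ℝ) 1) ∧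
      (∀ x ≤ (0 : ℝ), u x = 0) ∧
      (∀ x ∈ Ioo (0 : ℝ) (1 / 2), HasFracLap (1 / 2) u x (f x + deriv (deriv u) x))) ∧
      EqOn u (fun x => x + v x) (Icc 0 (1 / 2)) ∧ BB (-(1 / 4) + 2) v ∧ (∀ x ≤ 0, v x = 0) ∧
      BB (-(1 / 4) + (1 - 1 / 2)) e ∧
      ∀ x ∈ Ioo (0 : ℝ) (1 / 2), deriv (deriv v) x = c * Real.log x + e x := by
  have hκ := fracConst_pos (s := 1 / 2) (by norm_num) (by norm_num)
  refine ⟨fracConst (1 / 2), hκ.ne', ?_⟩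
  refine construct (p := fun x => fracConst (1 / 2) * -Real.log (1 - x)) (by norm_num)
    (by norm_num) k (by norm_num)
    ((BB.log (show (0 : ℝ) < 1 / 4 by norm_num)).const_mul _) ?_ ?_
  · refine contDiffOn_const.mul (ContDiffOn.neg (ContDiffOn.log (by fun_prop) fun x hx => ?_))
    have := hx.2
    exact ne_of_gt (by linarith)
  · intro x hx
    rw [clamp_lap_half hx.1 hx.2]
    ring

end Final

/-- Sharpness of the boundary regularity: for every `k` there are
`f_k ∈ C^k([0,1/2])` and a solution `u_k` of `-u'' + (-Δ)^s u = f` in `(0,1/2)`,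
vanishing on `(-∞, 0]`, whose regularity on `[0,1/2]` is exactly `C^{2,1-2s}`
(if `s < 1/2`), `⋂_{ε} C^{1,1-ε} ∖ C^{1,1}` (if `s = 1/2`), or `C^{1,2-2s}`
(if `s > 1/2`). -/
theorem boundary_regularity_sharpness
    (s : ℝ) (hs : s ∈ Ioo (0 : ℝ) 1) (k : ℕ) :
    ∃ f u : ℝ → ℝ,
      ContDiffOn ℝ k f (Icc (0 : ℝ) (1 / 2)) ∧
      (∃ M : ℝ, ∀ x, |u x| ≤ M) ∧ Continuous u ∧
      ContDiffOn ℝ (⊤ : ℕ∞) u (Ioo (0 : ℝ) 1) ∧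
      (∀ x ≤ (0 : ℝ), u x = 0) ∧
      (∀ x ∈ Ioo (0 : ℝ) (1 / 2), HasFracLap s u x (f x + deriv (deriv u) x)) ∧
      (s < 1 / 2 →
        HolderIcc 2 (1 - 2 * s) u ∧ ∀ ε > (0 : ℝ), ¬ HolderIcc 2 (1 - 2 * s + ε) u) ∧
      (s = 1 / 2 →
        (∀ ε ∈ Ioo (0 : ℝ) 1, HolderIcc 1 (1 - ε) u) ∧ ¬ HolderIcc 1 1 u) ∧
      (1 / 2 < s →
        HolderIcc 1 (2 - 2 * s) u ∧ ∀ ε > (0 : ℝ), ¬ HolderIcc 1 (2 - 2 * s + ε) u) := by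
  obtain ⟨hs0, hs1⟩ := hs
  rcases lt_trichotomy s (1 / 2) with hlt | heq | hgt
  · obtain ⟨c, hc, f, u, v, e, ⟨a1, a2, a3, a4, a5, a6⟩, hu, hv, hv0, he, hve⟩ :=
      case_ne hs0 hs1 hlt.ne k
    refine ⟨f, u, a1, a2, a3, a4, a5, a6, fun _ => ?_, fun h => absurd h hlt.ne,
      fun h => absurd h (not_lt.2 hlt.le)⟩
    have hC : ContDiff ℝ 2 v := by
      exact_mod_cast hv.contDiff 2 (by push_cast; linarith) hv0
    have z1 := hv.deriv_left (by linarith) hv0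
    have z2 := hv.deriv.deriv_left (by linarith) z1
    have b2 : BB (1 - 2 * s) (deriv (deriv v)) := hv.deriv.deriv.mono (by linarith)
    refine ⟨(holder2_iff hu hC).2 ?_, fun ε hε hH => ?_⟩
    · obtain ⟨C, hC⟩ := b2.holder (by linarith) (by linarith) z2
      exact ⟨C, fun x hx y hy => hC x ⟨hx.1, by linarith [hx.2]⟩ y ⟨hy.1, by linarith [hy.2]⟩⟩
    · exact sharp_rpow hc (show 0 < 1 - s by linarith) hε (z2 0 le_rfl) he hve
        ((holder2_iff hu hC).1 hH)
  · subst heq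
    obtain ⟨c, hc, f, u, v, e, ⟨a1, a2, a3, a4, a5, a6⟩, hu, hv, hv0, he, hve⟩ := case_half k
    refine ⟨f, u, a1, a2, a3, a4, a5, a6, fun h => absurd h (lt_irrefl _), fun _ => ?_,
      fun h => absurd h (lt_irrefl _)⟩
    have hC : ContDiff ℝ 1 v := by
      exact_mod_cast hv.contDiff 1 (by norm_num) hv0
    have z1 := hv.deriv_left (by norm_num) hv0
    have hgl : ∀ {η : ℝ}, 0 < η → BB (-η) (fun x => c * Real.log x) :=
      fun hη => (BB.log hη).const_mul c
    have hexp := fun x (hx : x ∈ Ioo (0 : ℝ) (1 / 2)) =>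
      deriv_expand (by norm_num) (by norm_num) (hgl (show (0 : ℝ) < 1 / 4 by norm_num)) he hv hv0
        hve hx
    have hE := he.integral (by norm_num)
    refine ⟨fun ε hε => (holder1_iff hu hC).2 ?_, fun hH => ?_⟩
    · set w : ℝ → ℝ := fun x => if x ≤ 0 then 0 else
        (∫ t in (0 : ℝ)..x, c * Real.log t) + ∫ t in (0 : ℝ)..x, e t with hw
      have hε1 := hε.1
      have hε2 := hε.2
      have w0 : ∀ x ≤ 0, w x = 0 := fun x hx => if_pos hx
      have bw : BB (1 - ε) w := by
        have h1 : BB (1 - ε) _ := ((hgl hε1).integral (by linarith)).mono (by linarith)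
        have h2 : BB (1 - ε) _ := hE.mono (by linarith)
        exact (h1.add h2).congr fun x hx => (if_neg (not_le.2 hx)).symm
      obtain ⟨C, hCw⟩ := bw.holder (by linarith) (by linarith) w0
      have hcv : Continuous (deriv v) := hC.continuous_deriv le_rfl
      have hcw : Continuous w := bw.continuous (by linarith) w0
      have e1 : EqOn (deriv v) w (Ioo 0 (1 / 2)) := fun x hx => by
        rw [hexp x hx, hw]
        exact (if_neg (not_le.2 hx.1)).symm
      have e2 := e1.closure hcv hcw
      rw [closure_Ioo (by norm_num)] at e2
      refine ⟨C, fun x hx y hy => ?_⟩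
      rw [e2 hx, e2 hy]
      exact hCw x ⟨hx.1, by linarith [hx.2]⟩ y ⟨hy.1, by linarith [hy.2]⟩
    · refine sharp_log (d := 1 / 4) (w := deriv v) hc (by norm_num) (z1 0 le_rfl)
        (hE.mono (by norm_num)) (fun x hx => ?_) ((holder1_iff hu hC).1 hH)
      rw [hexp x hx, intervalIntegral.integral_const_mul, integral_log]
      simp
  · obtain ⟨c, hc, f, u, v, e, ⟨a1, a2, a3, a4, a5, a6⟩, hu, hv, hv0, he, hve⟩ :=
      case_ne hs0 hs1 hgt.ne' k
    refine ⟨f, u, a1, a2, a3, a4, a5, a6, fun h => absurd h (not_lt.2 hgt.le),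
      fun h => absurd h hgt.ne', fun _ => ?_⟩
    have hC : ContDiff ℝ 1 v := by
      exact_mod_cast hv.contDiff 1 (by push_cast; linarith) hv0
    have z1 := hv.deriv_left (by linarith) hv0
    have b1 : BB (2 - 2 * s) (deriv v) := hv.deriv.mono (by linarith)
    refine ⟨(holder1_iff hu hC).2 ?_, fun ε hε hH => ?_⟩
    · obtain ⟨C, hC⟩ := b1.holder (by linarith) (by linarith) z1
      exact ⟨C, fun x hx y hy => hC x ⟨hx.1, by linarith [hx.2]⟩ y ⟨hy.1, by linarith [hy.2]⟩⟩
    · have h22 : 2 - 2 * s ≠ 0 := by intro h; linarith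
      refine sharp_rpow (w := deriv v) (c := c / (2 - 2 * s)) (div_ne_zero hc h22)
        (show 0 < 1 - s by linarith) hε (z1 0 le_rfl)
        ((he.integral (by linarith)).mono (by linarith)) (fun x hx => ?_) ((holder1_iff hu hC).1 hH)
      rw [deriv_expand (by linarith) (by linarith) ((BB.rpow (1 - 2 * s)).const_mul c) he hv hv0
        hve hx, intervalIntegral.integral_const_mul, integral_rpow (Or.inl (by linarith)),
        show 1 - 2 * s + 1 = 2 - 2 * s by ring, Real.zero_rpow h22]
      ring
end

section
/- Let s ∈ (0,1), α ∈ (0,∞), and j ∈ ℕ ∪ {0}. Then there exist real constants a_{α,j}^{(0)}, …, a_{α,j}^{(j+1)} and a function f_{α,j} ∈ C^∞([0, 1/2]) such that (−Δ)^s u_{α,j}(x) = x^{α−2s} Σ_{k=0}^{j+1} a_{α,j}^{(k)} log^k x + f_{α,j}(x) for every x ∈ (0, 1/2). Furthermore, a_{α,j}^{(j+1)} = 0 when α − 2s ∉ ℕ ∪ {0}, and a_{α,j}^{(0)} = 0 when α − 2s ∈ ℕ ∪ {0}. In addition, a_{1,0}^{(0)} ≠ 0 if s ≠ 1/2, and a_{1,0}^{(1)}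 ≠ 0 if s = 1/2. -/
open Filter MeasureTheory Set
open scoped Topology

/-- `t ^ α * log t ^ j`. -/
noncomputable def vfun (α : ℝ) (j : ℕ) (t : ℝ) : ℝ := t ^ α * Real.log t ^ j

lemma anti_aux (M : ℝ) (j : ℕ) : ∃ B : ℝ, ∀ γ : ℝ, γ ≠ 0 → |γ|⁻¹ ≤ M →
    ∃ P : Polynomial ℝ, P.natDegree ≤ j ∧ (∀ k, |P.coeff k| ≤ B) ∧
      ∀ y : ℝ, 0 < y → HasDerivAt (fun y : ℝ => y ^ γ * P.eval (Real.log y))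
        (y ^ (γ - 1) * Real.log y ^ j) y := by
  induction j with
  | zero =>
    refine ⟨M, fun γ hγ hM => ⟨Polynomial.C γ⁻¹, by simp, ?_, ?_⟩⟩
    · intro k
      have hM0 : 0 ≤ M := le_trans (by positivity) hM
      rw [Polynomial.coeff_C]
      split_ifs
      · rw [abs_inv]; exact hM
      · simpa using hM0
    · intro y hy
      have h := (Real.hasDerivAt_rpow_const (x := y) (p := γ) (Or.inl hy.ne')).mul_const γ⁻¹
      simp only [Polynomial.eval_C]
      convert! h using 1
      field_simp
  | succ j ih =>
    obtain ⟨B, hB⟩ := ih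
    refine ⟨M + (j + 1) * M * B, fun γ hγ hM => ?_⟩
    have hM0 : 0 ≤ M := le_trans (by positivity) hM
    obtain ⟨P, hd, hc, hder⟩ := hB γ hγ hM
    refine ⟨Polynomial.C γ⁻¹ * Polynomial.X ^ (j + 1) - Polynomial.C ((j + 1) * γ⁻¹) * P, ?_, ?_, ?_⟩
    · refine (Polynomial.natDegree_sub_le _ _).trans (max_le ?_ ?_)
      · exact Polynomial.natDegree_C_mul_X_pow_le _ _
      · exact (Polynomial.natDegree_C_mul_le _ _).trans (by omega)
    · intro k
      rw [Polynomial.coeff_sub, Polynomial.coeff_C_mul, Polynomial.coeff_C_mul]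
      refine (abs_sub _ _).trans (add_le_add ?_ ?_)
      · rw [Polynomial.coeff_X_pow]
        split_ifs
        · rw [mul_one, abs_inv]; exact hM
        · simpa using hM0
      · rw [abs_mul, abs_mul, abs_inv]
        have h1 : |(j : ℝ) + 1| = j + 1 := abs_of_pos (by positivity)
        rw [h1]
        have := hc k
        have hB0 : 0 ≤ B := (abs_nonneg _).trans this
        gcongr
    · intro y hy
      have h1 := (Real.hasDerivAt_rpow_const (x := y) (p := γ) (Or.inl hy.ne'))
      have h2 := ((Real.hasDerivAt_log hy.ne').pow (j + 1)).const_mul γ⁻¹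
      have h3 := (h1.mul h2).sub ((hder y hy).const_mul ((j + 1) * γ⁻¹))
      convert! h3 using 1
      · ext t
        simp only [Polynomial.eval_sub, Polynomial.eval_mul, Polynomial.eval_C, Polynomial.eval_pow, Polynomial.eval_X, Pi.sub_apply, Pi.mul_apply, Pi.pow_apply]
        ring
      · have hy' : y ^ γ = y ^ (γ - 1) * y := by
          rw [Real.rpow_sub_one hy.ne']; field_simp
        rw [hy']
        simp only [Pi.pow_apply]
        push_cast
        field_simp
        ring_nf

lemma anti_all (β : ℝ) (j : ℕ) : ∃ B : ℝ, ∃ P : ℕ → Polynomial ℝ, ∀ n : ℕ,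
    (P n).natDegree ≤ j + 1 ∧ ((¬ ∃ m : ℕ, β = m) → (P n).natDegree ≤ j) ∧
    (∀ k, |(P n).coeff k| ≤ B) ∧
      ∀ y : ℝ, 0 < y → HasDerivAt (fun y : ℝ => y ^ (β - n) * (P n).eval (Real.log y))
        (y ^ (β - n - 1) * Real.log y ^ j) y := by
  have hT : Tendsto (fun n : ℕ => |β - n|⁻¹) atTop (𝓝 0) := by
    apply Filter.Tendsto.inv_tendsto_atTop
    apply tendsto_abs_atBot_atTop.comp
    have := tendsto_natCast_atTop_atTop (R := ℝ)
    exact tendsto_atBot_add_const_left _ β (tendsto_neg_atTop_atBot.comp this)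
  obtain ⟨M, hM⟩ := hT.bddAbove_range
  obtain ⟨B, hB⟩ := anti_aux M j
  have key : ∀ n : ℕ, ∃ P : Polynomial ℝ, P.natDegree ≤ j + 1 ∧ ((¬ ∃ m : ℕ, β = m) → P.natDegree ≤ j) ∧
    (∀ k, |P.coeff k| ≤ max B 1) ∧
      ∀ y : ℝ, 0 < y → HasDerivAt (fun y : ℝ => y ^ (β - n) * P.eval (Real.log y))
        (y ^ (β - n - 1) * Real.log y ^ j) y := by
    intro n
    by_cases hn : β - n = 0
    · refine ⟨Polynomial.C ((j : ℝ) + 1)⁻¹ * Polynomial.X ^ (j + 1), Polynomial.natDegree_C_mul_X_pow_le _ _, ?_, ?_, ?_⟩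
      · intro h; exact absurd ⟨n, by linarith⟩ h
      · intro k
        refine le_trans ?_ (le_max_right _ _)
        rw [Polynomial.coeff_C_mul, Polynomial.coeff_X_pow]
        split_ifs
        · rw [mul_one, abs_inv, abs_of_pos (by positivity)]
          exact inv_le_one_of_one_le₀ (by linarith [(Nat.cast_nonneg j : (0:ℝ) ≤ j)])
        · simp
      · intro y hy
        rw [hn]
        have h2 := ((Real.hasDerivAt_log hy.ne').pow (j + 1)).const_mul ((j : ℝ) + 1)⁻¹
        convert! h2 using 1
        · ext t
          simp
        · rw [zero_sub, Real.rpow_neg_one]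
          push_cast
          field_simp
          try simp
    · obtain ⟨P, h1, h2, h3⟩ := hB (β - n) hn (hM ⟨n, rfl⟩)
      exact ⟨P, by omega, fun _ => h1, fun k => (h2 k).trans (le_max_left _ _), h3⟩
  choose P hP using key
  exact ⟨max B 1, P, hP⟩

lemma binom_series (σ : ℝ) : ∃ d : ℕ → ℝ,
    (∀ r : ℝ, 0 ≤ r → r < 1 → Summable fun n => |d n| * r ^ n) ∧
    ∀ z : ℝ, |z| < 1 → HasSum (fun n => d n * z ^ n) ((1 - z) ^ (-σ)) := by
  have h := Real.one_add_rpow_hasFPowerSeriesOnBall_zero (a := -σ)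
  refine ⟨fun n => (-1) ^ n * Ring.choose (-σ) n, ?_, ?_⟩
  · intro r hr hr1
    lift r to NNReal using hr
    have h1 := (binomialSeries ℝ (-σ)).summable_norm_mul_pow (r := r)
      (lt_of_lt_of_le (by exact_mod_cast hr1) h.r_le)
    refine h1.congr fun n => ?_
    simp [binomialSeries, abs_mul]
  · intro z hz
    have h1 := h.hasSum (y := -z) (by simpa [enorm_eq_nnnorm, ← NNReal.coe_lt_one] using hz)
    simp only [zero_add, ← sub_eq_add_neg] at h1
    rw [show (1:ℝ) + (0 - z) = 1 - z by ring] at h1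
    convert! h1 using 1
    ext n
    simp only [binomialSeries, FormalMultilinearSeries.ofScalars_apply_eq, smul_eq_mul]
    rw [neg_pow z n]
    ring

lemma smooth_series (b : ℕ → ℝ) (hb : ∀ r : ℝ, 0 ≤ r → r < 1 → Summable fun n => |b n| * r ^ n) :
    ContDiffOn ℝ (⊤ : ℕ∞) (fun x => ∑' n, b n * x ^ n) (Icc (0 : ℝ) (1 / 2)) := by
  set p := FormalMultilinearSeries.ofScalars ℝ b with hp
  have hr : ((3/4 : NNReal) : ENNReal) ≤ p.radius := by
    apply p.le_radius_of_summable
    refine (hb (3/4) (by norm_num) (by norm_num)).congr fun n => ?_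
    simp [hp]
  have hpos : 0 < p.radius := lt_of_lt_of_le (by norm_num) hr
  have h := (p.hasFPowerSeriesOnBall hpos).analyticOnNhd
  have hs : p.sum = fun x => ∑' n, b n * x ^ n := by
    ext x
    simp [FormalMultilinearSeries.sum, hp, mul_comm]
  rw [← hs]
  refine (h.mono ?_).contDiffOn (uniqueDiffOn_Icc (by norm_num))
  intro x hx
  simp only [Metric.mem_eball, edist_zero_right]
  refine lt_of_lt_of_le ?_ hr
  rw [enorm_eq_nnnorm]
  rw [ENNReal.coe_lt_coe, ← NNReal.coe_lt_coe]
  simp only [coe_nnnorm, Real.norm_eq_abs]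
  rw [abs_of_nonneg hx.1]
  have := hx.2
  push_cast
  linarith

lemma J_general (s α : ℝ) (j : ℕ) : ∃ Q : Polynomial ℝ, ∃ F : ℝ → ℝ,
    ContDiffOn ℝ (⊤ : ℕ∞) F (Icc (0 : ℝ) (1 / 2)) ∧ Q.natDegree ≤ j + 1 ∧
    ((¬ ∃ m : ℕ, α - 2 * s = m) → Q.natDegree ≤ j) ∧
    ∀ x ∈ Ioo (0 : ℝ) (1 / 2), ∫ h in x..(1 - x), vfun α j (x + h) * h ^ (-(1 + 2 * s)) =
      F x - x ^ (α - 2 * s) * Q.eval (Real.log x) := by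
  obtain ⟨B, P, hP⟩ := anti_all (α - 2 * s) j
  obtain ⟨d, hd, hdz⟩ := binom_series (1 + 2 * s)
  set β := α - 2 * s with hβ
  have hB0 : 0 ≤ B := (abs_nonneg _).trans ((hP 0).2.2.1 0)
  have hsum : ∀ r : ℝ, 0 ≤ r → r < 1 → ∀ k, Summable fun n => |d n * (P n).coeff k| * r ^ n := by
    intro r hr hr1 k
    refine Summable.of_nonneg_of_le (fun n => by positivity) (fun n => ?_) ((hd r hr hr1).mul_left B)
    rw [abs_mul]
    calc |d n| * |(P n).coeff k| * r ^ n ≤ |d n| * B * r ^ n := by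
          gcongr; exact (hP n).2.2.1 k
      _ = B * (|d n| * r ^ n) := by ring
  have hsum' : ∀ r : ℝ, 0 ≤ r → r < 1 → ∀ k, Summable fun n => d n * (P n).coeff k * r ^ n := by
    intro r hr hr1 k
    refine Summable.of_norm ?_
    refine (hsum r hr hr1 k).congr fun n => ?_
    rw [norm_mul, Real.norm_eq_abs, Real.norm_eq_abs, abs_of_nonneg (pow_nonneg hr n)]
  set q : ℕ → ℝ := fun k => ∑' n, d n * (P n).coeff k * (1 / 2) ^ n with hq
  have hqk : ∀ k, HasSum (fun n => d n * (P n).coeff k * (1 / 2) ^ n) (q k) :=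
    fun k => (hsum' (1 / 2) (by norm_num) (by norm_num) k).hasSum
  set Q0 : Polynomial ℝ := ∑ k ∈ Finset.range (j + 2), Polynomial.C (q k) * Polynomial.X ^ k with hQ0
  have hQdeg : Q0.natDegree ≤ j + 1 := by
    apply Polynomial.natDegree_sum_le_of_forall_le
    intro k hk
    have := Finset.mem_range.mp hk
    exact (Polynomial.natDegree_C_mul_X_pow_le _ _).trans (by omega)
  have hQdeg' : (¬ ∃ m : ℕ, β = m) → Q0.natDegree ≤ j := by
    intro hm
    have hz : q (j + 1) = 0 := by
      rw [hq]
      have : ∀ n, d n * (P n).coeff (j + 1) * (1 / 2 : ℝ) ^ n = 0 := by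
        intro n
        rw [Polynomial.coeff_eq_zero_of_natDegree_lt (lt_of_le_of_lt ((hP n).2.1 hm) (Nat.lt_succ_self j))]
        ring
      simp only [this, tsum_zero]
    apply Polynomial.natDegree_sum_le_of_forall_le
    intro k hk
    have := Finset.mem_range.mp hk
    rcases Nat.lt_or_ge k (j + 1) with h | h
    · exact (Polynomial.natDegree_C_mul_X_pow_le _ _).trans (by omega)
    · have : k = j + 1 := by omega
      subst this
      rw [hz]; simp
  have hcomp : (Polynomial.C (2 ^ β) * Q0.comp (Polynomial.X + Polynomial.C (Real.log 2))).natDegree ≤ Q0.natDegree := by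
    refine (Polynomial.natDegree_C_mul_le _ _).trans (Polynomial.natDegree_comp_le.trans ?_)
    rw [Polynomial.natDegree_X_add_C, mul_one]
  refine ⟨Polynomial.C (2 ^ β) * Q0.comp (Polynomial.X + Polynomial.C (Real.log 2)),
    fun x => ∑' n, (d n * (P n).coeff 0) * x ^ n, smooth_series _ (fun r hr hr1 => hsum r hr hr1 0),
    hcomp.trans hQdeg, fun h => hcomp.trans (hQdeg' h), ?_⟩
  rintro x ⟨hx0, hx1⟩
  have h2x : (0:ℝ) < 2 * x := by linarith
  have e1 : ∫ h in x..(1 - x), vfun α j (x + h) * h ^ (-(1 + 2 * s)) =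
      ∫ y in (2 * x)..1, vfun α j y * (y - x) ^ (-(1 + 2 * s)) := by
    have := intervalIntegral.integral_comp_add_left (a := x) (b := 1 - x)
      (fun y => vfun α j y * (y - x) ^ (-(1 + 2 * s))) x
    simp only [add_sub_cancel_left] at this
    rw [this]
    congr 1 <;> ring
  rw [e1]
  have hIcc : ∀ y ∈ uIcc (2 * x) 1, 0 < y := by
    intro y hy
    rw [uIcc_of_le (by linarith)] at hy
    linarith [hy.1]
  have hcont : ∀ γ : ℝ, ContinuousOn (fun y : ℝ => y ^ γ * Real.log y ^ j) (uIcc (2 * x) 1) := by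
    intro γ y hy
    have := hIcc y hy
    exact ((Real.continuousAt_rpow_const _ _ (Or.inl this.ne')).mul
      ((Real.continuousAt_log this.ne').pow j)).continuousWithinAt
  -- termwise integrals
  have hterm : ∀ n : ℕ, ∫ y in (2 * x)..1, d n * x ^ n * (y ^ (β - n - 1) * Real.log y ^ j) =
      d n * (P n).coeff 0 * x ^ n
        - (2 * x) ^ β * (d n * (P n).eval (Real.log (2 * x)) * (1 / 2) ^ n) := by
    intro n
    rw [intervalIntegral.integral_const_mul]
    rw [intervalIntegral.integral_eq_sub_of_hasDerivAt
      (f := fun y : ℝ => y ^ (β - n) * (P n).eval (Real.log y))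
      (fun y hy => (hP n).2.2.2 y (hIcc y hy)) (hcont _).intervalIntegrable]
    simp only [Real.one_rpow, Real.log_one, one_mul]
    rw [← Polynomial.coeff_zero_eq_eval_zero, Real.rpow_sub_natCast h2x.ne']
    rw [mul_pow, div_pow, one_pow]
    field_simp
  have hS1 : HasSum (fun n : ℕ => ∫ y in (2 * x)..1, d n * x ^ n * (y ^ (β - n - 1) * Real.log y ^ j))
      (∫ y in (2 * x)..1, vfun α j y * (y - x) ^ (-(1 + 2 * s))) := by
    apply intervalIntegral.hasSum_integral_of_dominated_convergence
      (fun n y => |d n| * (1 / 2) ^ n * ‖y ^ (β - 1) * Real.log y ^ j‖)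
    · intro n
      refine ContinuousOn.aestronglyMeasurable ?_ measurableSet_uIoc
      exact (continuousOn_const.mul (hcont _)).mono uIoc_subset_uIcc
    · intro n
      refine Filter.Eventually.of_forall fun y hy => ?_
      have hy0 := hIcc y (uIoc_subset_uIcc hy)
      rw [uIoc_of_le (by linarith)] at hy
      have : y ^ (β - n - 1) = y ^ (β - 1) / y ^ n := by
        rw [← Real.rpow_sub_natCast hy0.ne']; congr 1; ring
      rw [this]
      have e : d n * x ^ n * (y ^ (β - 1) / y ^ n * Real.log y ^ j) =
        d n * (x / y) ^ n * (y ^ (β - 1) * Real.log y ^ j) := by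
        rw [div_pow]; ring
      rw [e, norm_mul, norm_mul, norm_pow, Real.norm_eq_abs (d n), Real.norm_eq_abs (x / y)]
      have : |x / y| ≤ 1 / 2 := by
        rw [abs_of_pos (by positivity), div_le_div_iff₀ hy0 (by norm_num)]
        linarith [hy.1]
      gcongr
    · refine Filter.Eventually.of_forall fun y hy => ?_
      exact (hd (1 / 2) (by norm_num) (by norm_num)).mul_right _
    · simp only [tsum_mul_right]
      exact (continuousOn_const.mul (hcont _).norm).intervalIntegrable
    · refine Filter.Eventually.of_forall fun y hy => ?_
      have hy0 := hIcc y (uIoc_subset_uIcc hy)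
      rw [uIoc_of_le (by linarith)] at hy
      have hz : |x / y| < 1 := by
        rw [abs_of_pos (by positivity), div_lt_one hy0]
        linarith [hy.1]
      have h1 := (hdz (x / y) hz).mul_right (y ^ (β - 1) * Real.log y ^ j)
      convert! h1 using 1
      · ext n
        have : y ^ (β - n - 1) = y ^ (β - 1) / y ^ n := by
          rw [← Real.rpow_sub_natCast hy0.ne']; congr 1; ring
        rw [this, div_pow]; ring
      · have h3 : y - x = y * (1 - x / y) := by field_simp
        have h4 : 0 ≤ 1 - x / y := by
          have := (abs_lt.mp hz).2; linarith
        rw [h3, Real.mul_rpow hy0.le h4]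
        have h5 : y ^ (β - 1) = y ^ α * y ^ (-(1 + 2 * s)) := by
          rw [← Real.rpow_add hy0]; congr 1; rw [hβ]; ring
        rw [h5, vfun]; ring
  have hS2 : HasSum (fun n : ℕ => d n * (P n).eval (Real.log (2 * x)) * (1 / 2) ^ n)
      (Q0.eval (Real.log (2 * x))) := by
    have h1 := hasSum_sum (s := Finset.range (j + 2)) (fun k _ => (hqk k).mul_right (Real.log (2 * x) ^ k))
    convert! h1 using 1
    · ext n
      rw [Polynomial.eval_eq_sum_range' (n := j + 2) (lt_of_le_of_lt (hP n).1 (Nat.lt_succ_self _))]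
      rw [Finset.mul_sum, Finset.sum_mul]
      refine Finset.sum_congr rfl fun k _ => ?_
      ring
    · rw [hQ0, Polynomial.eval_finset_sum]
      simp
  have hS3 := ((hsum' x hx0.le (by linarith) 0).hasSum).sub (hS2.mul_left ((2 * x) ^ β))
  simp only [hterm] at hS1
  rw [hS1.unique hS3]
  rw [Polynomial.eval_mul, Polynomial.eval_comp, Polynomial.eval_C, Polynomial.eval_add, Polynomial.eval_X, Polynomial.eval_C,
    Real.mul_rpow (by norm_num) hx0.le, Real.log_mul (by norm_num) hx0.ne', add_comm (Real.log 2)]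
  ring

lemma J_special (s : ℝ) (hs : s ∈ Ioo (0 : ℝ) 1) : ∃ Q : Polynomial ℝ, ∃ F : ℝ → ℝ,
    ContDiffOn ℝ (⊤ : ℕ∞) F (Icc (0 : ℝ) (1 / 2)) ∧ Q.natDegree ≤ 0 + 1 ∧
    ((¬ ∃ m : ℕ, 1 - 2 * s = m) → Q.natDegree ≤ 0) ∧
    (∀ x ∈ Ioo (0 : ℝ) (1 / 2), ∫ h in x..(1 - x), vfun 1 0 (x + h) * h ^ (-(1 + 2 * s)) =
      F x - x ^ (1 - 2 * s) * Q.eval (Real.log x)) ∧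
    (s ≠ 1 / 2 → Q.coeff 0 = 1 / (1 - 2 * s) - 1 / (2 * s)) ∧
    (s = 1 / 2 → Q.coeff 1 = 1) := by
  obtain ⟨hs0, hs1⟩ := hs
  have hne : ∀ x ∈ Icc (0 : ℝ) (1 / 2), 1 - x ≠ 0 := by
    intro x hx; have := hx.2; intro h; linarith
  have hsm : ContDiffOn ℝ (⊤ : ℕ∞) (fun x : ℝ => 1 - x) (Icc (0 : ℝ) (1 / 2)) := by fun_prop
  have hIcc : ∀ x ∈ Ioo (0 : ℝ) (1 / 2), ∀ y ∈ uIcc x (1 - x), 0 < y := by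
    intro x hx y hy
    rw [uIcc_of_le (by linarith [hx.2])] at hy
    linarith [hy.1, hx.1]
  have hcont : ∀ x ∈ Ioo (0 : ℝ) (1 / 2), ContinuousOn (fun h : ℝ => vfun 1 0 (x + h) * h ^ (-(1 + 2 * s))) (uIcc x (1 - x)) := by
    intro x hx h hh
    have := hIcc x hx h hh
    simp only [vfun, Real.rpow_one, pow_zero, mul_one]
    exact (ContinuousAt.mul (by fun_prop) (Real.continuousAt_rpow_const _ _ (Or.inl this.ne'))).continuousWithinAt
  by_cases h : s = 1 / 2
  · refine ⟨Polynomial.X - Polynomial.C 1, fun x => Real.log (1 - x) - x * (1 - x)⁻¹, ?_, ?_, ?_, ?_, ?_, ?_⟩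
    · exact (hsm.log hne).sub (contDiffOn_id.mul (hsm.inv hne))
    · rw [Polynomial.natDegree_X_sub_C]
    · intro h'; exact absurd ⟨0, by rw [h]; norm_num⟩ h'
    · intro x hx
      rw [intervalIntegral.integral_eq_sub_of_hasDerivAt (f := fun h => Real.log h - x * h⁻¹) _ (hcont x hx).intervalIntegrable]
      · have := hx.1
        rw [h]
        simp
        field_simp
        try ring
      · intro y hy
        have hy0 := hIcc x hx y hy
        have h1 := (Real.hasDerivAt_log hy0.ne').sub ((hasDerivAt_inv hy0.ne').const_mul x)
        convert! h1 using 1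
        rw [h, show -(1 + 2 * (1 / 2 : ℝ)) = -((2:ℕ):ℝ) by norm_num, Real.rpow_neg hy0.le, Real.rpow_natCast]
        simp only [vfun, Real.rpow_one, pow_zero, mul_one]
        field_simp
        try ring
    · intro h'; exact absurd h h'
    · intro _
      simp [Polynomial.coeff_one]
  · have h12 : 1 - 2 * s ≠ 0 := by intro h'; apply h; linarith
    refine ⟨Polynomial.C (1 / (1 - 2 * s) - 1 / (2 * s)),
      fun x => (1 - x) ^ (1 - 2 * s) * (1 - 2 * s)⁻¹ - x * ((1 - x) ^ (-(2 * s)) * (2 * s)⁻¹), ?_, ?_, ?_, ?_, ?_, ?_⟩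
    · exact ((hsm.rpow_const_of_ne hne).mul contDiffOn_const).sub
        (contDiffOn_id.mul ((hsm.rpow_const_of_ne hne).mul contDiffOn_const))
    · rw [Polynomial.natDegree_C]; exact Nat.zero_le _
    · intro _; rw [Polynomial.natDegree_C]
    · intro x hx
      rw [intervalIntegral.integral_eq_sub_of_hasDerivAt (f := fun h => h ^ (1 - 2 * s) * (1 - 2 * s)⁻¹ - x * (h ^ (-(2 * s)) * (2 * s)⁻¹)) _ (hcont x hx).intervalIntegrable]
      · have hx0 := hx.1
        have : x ^ (1 - 2 * s) = x * x ^ (-(2 * s)) := by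
          rw [sub_eq_add_neg, Real.rpow_add hx0, Real.rpow_one]
        simp only [Polynomial.eval_C]
        rw [this]
        ring
      · intro y hy
        have hy0 := hIcc x hx y hy
        have h1 := ((Real.hasDerivAt_rpow_const (x := y) (p := 1 - 2 * s) (Or.inl hy0.ne')).mul_const (1 - 2 * s)⁻¹).sub (((Real.hasDerivAt_rpow_const (x := y) (p := -(2 * s)) (Or.inl hy0.ne')).mul_const (2 * s)⁻¹).const_mul x)
        convert! h1 using 1
        have e1 : y ^ (1 - 2 * s - 1) = y * y ^ (-(1 + 2 * s)) := by
          rw [show 1 - 2 * s - 1 = 1 + (-(1 + 2 * s)) by ring, Real.rpow_add hy0, Real.rpow_one]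
        rw [e1, show -(2 * s) - 1 = -(1 + 2 * s) by ring]
        simp only [vfun, Real.rpow_one, pow_zero, mul_one]
        field_simp
        ring
    · intro _; exact Polynomial.coeff_C_zero
    · intro h'; exact absurd h' h

lemma vfun_zero (α : ℝ) (hα : 0 < α) (j : ℕ) : vfun α j 0 = 0 := by
  simp [vfun, Real.zero_rpow hα.ne']

lemma vfun_measurable (α : ℝ) (j : ℕ) : Measurable (vfun α j) := by
  unfold vfun
  fun_prop

lemma vfun_bdd (α : ℝ) (hα : 0 < α) (j : ℕ) : ∃ B : ℝ, 0 ≤ B ∧ ∀ t ∈ Icc (0 : ℝ) 2, |vfun α j t| ≤ B := by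
  have hc : ContinuousOn (vfun α j) (Icc 1 2) := by
    intro t ht
    have : (0:ℝ) < t := by linarith [ht.1]
    exact ((Real.continuousAt_rpow_const _ _ (Or.inl this.ne')).mul
      ((Real.continuousAt_log this.ne').pow j)).continuousWithinAt
  obtain ⟨B, hB⟩ := isCompact_Icc.exists_bound_of_continuousOn hc
  set τ := α / (j + 1) with hτ
  have hτ0 : 0 < τ := by positivity
  refine ⟨max B ((1 / τ) ^ j), le_max_of_le_right (by positivity), fun t ht => ?_⟩
  rcases eq_or_lt_of_le ht.1 with h0 | h0
  · rw [← h0, vfun_zero α hα, abs_zero]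
    exact le_max_of_le_right (by positivity)
  rcases le_or_gt 1 t with h1 | h1
  · exact (hB t ⟨h1, ht.2⟩).trans (le_max_left _ _)
  · refine le_trans ?_ (le_max_right _ _)
    have e : vfun α j t = t ^ τ * (Real.log t * t ^ τ) ^ j := by
      rw [vfun, mul_pow, ← Real.rpow_mul_natCast h0.le]
      have : t ^ α = t ^ τ * t ^ (τ * j) := by
        rw [← Real.rpow_add h0]; congr 1; rw [hτ]; field_simp; ring
      rw [this]; ring
    rw [e, abs_mul, abs_pow]
    have h2 : |t ^ τ| ≤ 1 := by
      rw [abs_of_pos (by positivity)]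
      exact Real.rpow_le_one h0.le h1.le hτ0.le
    have h3 := (Real.abs_log_mul_self_rpow_lt t τ h0 h1.le hτ0).le
    calc |t ^ τ| * |Real.log t * t ^ τ| ^ j ≤ 1 * (1 / τ) ^ j := by gcongr
      _ = _ := one_mul _

lemma w_bound (α : ℝ) (hα : 0 < α) (k : ℕ) : ∃ C : ℝ, ∀ t ∈ Ioc (0 : ℝ) 1,
    |2 * vfun α k 1 - vfun α k (1 + t) - vfun α k (1 - t)| ≤ C * t ^ 2 := by
  obtain ⟨B, hB0, hB⟩ := vfun_bdd α hα k
  set w : ℝ → ℝ := fun t => 2 * vfun α k 1 - vfun α k (1 + t) - vfun α k (1 - t) with hw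
  have hcd : ∀ t : ℝ, 0 < t → ContDiffAt ℝ 2 (vfun α k) t := by
    intro t ht
    exact (Real.contDiffAt_rpow_const_of_ne ht.ne').mul ((Real.contDiffAt_log.mpr ht.ne').pow k)
  have hsm : ContDiffOn ℝ (1 + 1) w (Icc 0 (1 / 2)) := by
    intro t ht
    have h1 : ContDiffAt ℝ 2 (fun t => vfun α k (1 + t)) t :=
      ContDiffAt.comp t (hcd (1 + t) (by linarith [ht.1])) (by fun_prop)
    have h2 : ContDiffAt ℝ 2 (fun t => vfun α k (1 - t)) t :=
      ContDiffAt.comp t (hcd (1 - t) (by linarith [ht.2])) (by fun_prop)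
    have := ((contDiffAt_const (c := 2 * vfun α k 1)).sub h1).sub h2
    rw [one_add_one_eq_two]
    exact this.contDiffWithinAt
  obtain ⟨C, hC⟩ := exists_taylor_mean_remainder_bound (n := 1) (by norm_num : (0:ℝ) ≤ 1 / 2) (by exact_mod_cast hsm)
  have hder : HasDerivAt w 0 0 := by
    have hv : HasDerivAt (vfun α k) (deriv (vfun α k) 1) 1 :=
      ((hcd 1 one_pos).differentiableAt (by norm_num)).hasDerivAt
    have h1 : HasDerivAt (fun t => vfun α k (1 + t)) (deriv (vfun α k) 1) 0 := by
      have := HasDerivAt.comp_const_add (f := vfun α k) (f' := deriv (vfun α k) 1) 1 0 (by simpa using hv)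
      simpa using this
    have h2 : HasDerivAt (fun t => vfun α k (1 - t)) (-deriv (vfun α k) 1) 0 := by
      have := HasDerivAt.comp_const_sub (f := vfun α k) (f' := deriv (vfun α k) 1) 1 0 (by simpa using hv)
      simpa using this
    have := ((hasDerivAt_const (0:ℝ) (2 * vfun α k 1)).sub h1).sub h2
    convert! this using 1
    ring
  have hw0 : w 0 = 0 := by simp [hw]; ring
  have hdw : derivWithin w (Icc 0 (1 / 2)) 0 = 0 :=
    hder.hasDerivWithinAt.derivWithin (uniqueDiffOn_Icc (by norm_num) 0 ⟨le_rfl, by norm_num⟩)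
  refine ⟨max C (16 * B), fun t ht => ?_⟩
  rcases le_or_gt t (1 / 2) with h | h
  · have h1 := hC t ⟨ht.1.le, h⟩
    rw [taylorWithinEval_succ, taylor_within_zero_eval, iteratedDerivWithin_one, hdw, hw0] at h1
    simp only [smul_zero, add_zero, sub_zero, Real.norm_eq_abs] at h1
    refine h1.trans ?_
    exact mul_le_mul_of_nonneg_right (le_max_left C (16 * B)) (pow_nonneg ht.1.le 2)
  · have h1 := hB 1 ⟨by norm_num, by norm_num⟩
    have h2 := hB (1 + t) ⟨by linarith, by linarith [ht.2]⟩
    have h3 := hB (1 - t) ⟨by linarith [ht.2], by linarith⟩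
    have h4 : |w t| ≤ 4 * B := by
      rw [hw]
      rw [abs_le] at *
      constructor <;> simp only <;> linarith [h1.1, h1.2, h2.1, h2.2, h3.1, h3.2]
    refine h4.trans ?_
    have : 16 * B * t ^ 2 ≤ max C (16 * B) * t ^ 2 := by
      gcongr; exact le_max_right _ _
    nlinarith [mul_nonneg hB0 (by nlinarith : 0 ≤ t ^ 2 - 1 / 4)]

lemma w_integrable (s α : ℝ) (hs : s ∈ Ioo (0 : ℝ) 1) (hα : 0 < α) (k : ℕ) :
    IntegrableOn (fun t => (2 * vfun α k 1 - vfun α k (1 + t) - vfun α k (1 - t)) *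
      t ^ (-(1 + 2 * s))) (Ioc 0 1) := by
  obtain ⟨C, hC⟩ := w_bound α hα k
  have hv := vfun_measurable α k
  have hi : IntegrableOn (fun t : ℝ => C * t ^ (1 - 2 * s)) (Ioc 0 1) := by
    have := (intervalIntegral.intervalIntegrable_rpow' (a := 0) (b := 1) (r := 1 - 2 * s) (by linarith [hs.2])).const_mul C
    rwa [intervalIntegrable_iff_integrableOn_Ioc_of_le zero_le_one] at this
  refine Integrable.mono' hi (Measurable.aestronglyMeasurable (by fun_prop)) ?_
  refine (ae_restrict_iff' measurableSet_Ioc).mpr (Filter.Eventually.of_forall fun t ht => ?_)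
  rw [norm_mul, Real.norm_eq_abs, Real.norm_eq_abs, abs_of_pos (Real.rpow_pos_of_pos ht.1 _)]
  have e : C * t ^ (1 - 2 * s) = C * t ^ 2 * t ^ (-(1 + 2 * s)) := by
    rw [mul_assoc, ← Real.rpow_natCast, ← Real.rpow_add ht.1]
    congr 2; push_cast; ring
  rw [e]
  have := Real.rpow_pos_of_pos ht.1 (-(1 + 2 * s))
  gcongr
  exact hC t ht

lemma vfun_scale (α : ℝ) (hα : 0 < α) (j : ℕ) (x t : ℝ) (hx : 0 < x) (ht : 0 ≤ t) :
    vfun α j (x * t) = x ^ α * ∑ k ∈ Finset.range (j + 1),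
      (j.choose k * Real.log x ^ (j - k)) * vfun α k t := by
  rcases eq_or_lt_of_le ht with h | h
  · rw [← h, mul_zero]
    simp [vfun_zero α hα]
  · rw [vfun, Real.mul_rpow hx.le ht, Real.log_mul hx.ne' h.ne', add_comm, add_pow, mul_assoc, Finset.mul_sum]
    congr 1
    refine Finset.sum_congr rfl fun k _ => ?_
    rw [vfun]; ring

lemma mid_part (s α : ℝ) (hs : s ∈ Ioo (0 : ℝ) 1) (hα : 0 < α) (j : ℕ) :
    ∃ p : Polynomial ℝ, p.natDegree ≤ j ∧ (α = 1 → j = 0 → p = 0) ∧ ∀ x : ℝ, 0 < x →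
      IntervalIntegrable (fun h => (2 * vfun α j x - vfun α j (x + h) - vfun α j (x - h)) *
        h ^ (-(1 + 2 * s))) volume 0 x ∧
      ∫ h in (0:ℝ)..x, (2 * vfun α j x - vfun α j (x + h) - vfun α j (x - h)) *
        h ^ (-(1 + 2 * s)) = x ^ (α - 2 * s) * p.eval (Real.log x) := by
  set W : ℕ → ℝ → ℝ := fun k t => (2 * vfun α k 1 - vfun α k (1 + t) - vfun α k (1 - t)) *
      t ^ (-(1 + 2 * s)) with hW
  have hWi : ∀ k, IntervalIntegrable (W k) volume 0 1 := fun k => by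
    rw [intervalIntegrable_iff_integrableOn_Ioc_of_le zero_le_one]
    exact w_integrable s α hs hα k
  set m : ℕ → ℝ := fun k => ∫ t in (0:ℝ)..1, W k t with hm
  refine ⟨∑ k ∈ Finset.range (j + 1), Polynomial.C (j.choose k * m k) * Polynomial.X ^ (j - k), ?_, ?_, ?_⟩
  · apply Polynomial.natDegree_sum_le_of_forall_le
    intro k hk
    exact (Polynomial.natDegree_C_mul_X_pow_le _ _).trans (by omega)
  · rintro rfl rfl
    have : m 0 = 0 := by
      rw [hm]
      have : W 0 = fun t => 0 := by
        ext t
        simp only [hW, vfun, Real.rpow_one, pow_zero, mul_one]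
        ring
      simp [this]
    simp [this]
  · intro x hx
    set G : ℝ → ℝ := fun h => x ^ (α - (1 + 2 * s)) * ∑ k ∈ Finset.range (j + 1),
      (j.choose k * Real.log x ^ (j - k)) * W k (h / x) with hG
    have hpt : ∀ h ∈ Set.uIoc 0 x, (2 * vfun α j x - vfun α j (x + h) - vfun α j (x - h)) *
        h ^ (-(1 + 2 * s)) = G h := by
      intro h hh
      rw [uIoc_of_le hx.le] at hh
      have h0 : 0 ≤ h / x := div_nonneg hh.1.le hx.le
      have h1 : h / x ≤ 1 := (div_le_one hx).mpr hh.2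
      have e1 : x + h = x * (1 + h / x) := by field_simp
      have e2 : x - h = x * (1 - h / x) := by field_simp
      have e3 : vfun α j x = vfun α j (x * 1) := by rw [mul_one]
      have e4 : h ^ (-(1 + 2 * s)) = x ^ (-(1 + 2 * s)) * (h / x) ^ (-(1 + 2 * s)) := by
        rw [← Real.mul_rpow hx.le h0]; congr 1; field_simp
      rw [e1, e2, e3, vfun_scale α hα j x _ hx (by linarith : (0:ℝ) ≤ 1 + h / x),
        vfun_scale α hα j x _ hx (by linarith : (0:ℝ) ≤ 1 - h / x),
        vfun_scale α hα j x _ hx (by linarith : (0:ℝ) ≤ 1), e4, hG]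
      simp only [hW]
      rw [sub_eq_add_neg α, Real.rpow_add hx]
      rw [show ∀ A S1 S2 S3 b c : ℝ, (2 * (A * S1) - A * S2 - A * S3) * (b * c) = A * b * ((2 * S1 - S2 - S3) * c) by intros; ring]
      congr 1
      rw [Finset.mul_sum, ← Finset.sum_sub_distrib, ← Finset.sum_sub_distrib, Finset.sum_mul]
      refine Finset.sum_congr rfl fun k _ => ?_
      ring
    have hWx : ∀ k, IntervalIntegrable (fun h => W k (h / x)) volume 0 x := by
      intro k
      have := (hWi k).comp_mul_right (c := x⁻¹)
      simpa [div_eq_mul_inv] using this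
    have hGi : IntervalIntegrable G volume 0 x := by
      refine IntervalIntegrable.const_mul ?_ _
      have := IntervalIntegrable.sum (μ := volume) (a := 0) (b := x) (Finset.range (j + 1)) (f := fun k h => (j.choose k * Real.log x ^ (j - k)) * W k (h / x))
        (fun k _ => (hWx k).const_mul _)
      convert! this using 1
      ext h
      simp
    refine ⟨hGi.congr fun h hh => (hpt h hh).symm, ?_⟩
    rw [intervalIntegral.integral_congr_ae (Filter.Eventually.of_forall hpt)]
    rw [hG, intervalIntegral.integral_const_mul, intervalIntegral.integral_finset_sum (fun k _ => (hWx k).const_mul _)]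
    have hk : ∀ k, ∫ h in (0:ℝ)..x, (j.choose k * Real.log x ^ (j - k)) * W k (h / x) = x * ((j.choose k * Real.log x ^ (j - k)) * m k) := by
      intro k
      rw [intervalIntegral.integral_const_mul, intervalIntegral.integral_comp_div _ hx.ne', zero_div, div_self hx.ne', smul_eq_mul]
      ring
    simp only [hk]
    rw [← Finset.mul_sum, ← mul_assoc]
    have : x ^ (α - (1 + 2 * s)) * x = x ^ (α - 2 * s) := by
      rw [← Real.rpow_add_one hx.ne']; congr 1; ring
    rw [this, Polynomial.eval_finset_sum]
    congr 1
    refine Finset.sum_congr rfl fun k _ => ?_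
    simp
    ring

lemma D_integrable (s : ℝ) (hs : 0 < s) (g : ℝ → ℝ) (hg : Measurable g) (B : ℝ) (hB : ∀ h, |g h| ≤ B)
    (ε : ℝ) (hε : 0 < ε) : IntegrableOn (fun h => g h * h ^ (-(1 + 2 * s))) (Ioi ε) := by
  have h1 : IntegrableOn (fun h : ℝ => h ^ (-(1 + 2 * s))) (Ioi ε) :=
    integrableOn_Ioi_rpow_of_lt (by linarith) hε
  exact Integrable.bdd_mul (c := B) h1 hg.aestronglyMeasurable (Filter.Eventually.of_forall hB)

lemma fracTrunc_eq_s19 (s : ℝ) (hs : 0 < s) (u : ℝ → ℝ) (hu : Measurable u) (B : ℝ) (hB : ∀ y, |u y| ≤ B)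
    (x ε : ℝ) (hε : 0 < ε) : fracTrunc s u x ε =
      ∫ h in Ioi ε, (2 * u x - u (x + h) - u (x - h)) * h ^ (-(1 + 2 * s)) := by
  set f : ℝ → ℝ := fun y => (u x - u y) / |x - y| ^ (1 + 2 * s) with hf
  have hset : {y : ℝ | ε ≤ |x - y|} = Iic (x - ε) ∪ Ici (x + ε) := by
    ext y
    simp only [mem_setOf_eq, mem_union, mem_Iic, mem_Ici, le_abs]
    constructor
    · rintro (h | h)
      · left; linarith
      · right; linarith
    · rintro (h | h)
      · left; linarith
      · right; linarith
  have hdisj : Disjoint (Iio (x - ε)) (Ioi (x + ε)) := by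
    rw [Set.disjoint_left]
    intro y h1 h2
    have h1 := mem_Iio.mp h1
    have h2 := mem_Ioi.mp h2
    linarith
  have hae : ((Iic (x - ε) ∪ Ici (x + ε) : Set ℝ)) =ᵐ[volume] (Iio (x - ε) ∪ Ioi (x + ε) : Set ℝ) :=
    ae_eq_set_union Iio_ae_eq_Iic.symm Ioi_ae_eq_Ici.symm
  have mR : MeasurePreserving (fun h : ℝ => x + h) volume volume := measurePreserving_add_left volume x
  have eR : MeasurableEmbedding (fun h : ℝ => x + h) := measurableEmbedding_addLeft x
  have mL : MeasurePreserving (fun h : ℝ => x - h) volume volume := Measure.measurePreserving_sub_left volume x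
  have eL : MeasurableEmbedding (fun h : ℝ => x - h) := (MeasurableEquiv.subLeft x).measurableEmbedding
  have pR : (fun h : ℝ => x + h) ⁻¹' Ioi (x + ε) = Ioi ε := by ext h; simp
  have pL : (fun h : ℝ => x - h) ⁻¹' Iio (x - ε) = Ioi ε := by ext h; simp
  have fR : EqOn (fun h => f (x + h)) (fun h => (u x - u (x + h)) * h ^ (-(1 + 2 * s))) (Ioi ε) := by
    intro h hh
    have h0 : 0 < h := hε.trans hh
    simp only [hf]
    rw [show x - (x + h) = -h by ring, abs_neg, abs_of_pos h0, Real.rpow_neg h0.le, div_eq_mul_inv]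
  have fL : EqOn (fun h => f (x - h)) (fun h => (u x - u (x - h)) * h ^ (-(1 + 2 * s))) (Ioi ε) := by
    intro h hh
    have h0 : 0 < h := hε.trans hh
    simp only [hf]
    rw [show x - (x - h) = h by ring, abs_of_pos h0, Real.rpow_neg h0.le, div_eq_mul_inv]
  have hb : ∀ y, |u x - u y| ≤ 2 * B := by
    intro y
    have h1 := abs_le.mp (hB x)
    have h2 := abs_le.mp (hB y)
    rw [abs_le]; constructor <;> linarith [h1.1, h1.2, h2.1, h2.2]
  have iR' := D_integrable s hs (fun h => u x - u (x + h)) (by fun_prop) (2 * B) (fun h => hb _) ε hε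
  have iL' := D_integrable s hs (fun h => u x - u (x - h)) (by fun_prop) (2 * B) (fun h => hb _) ε hε
  have iR : IntegrableOn f (Ioi (x + ε)) := by
    rw [← mR.integrableOn_comp_preimage eR, pR]
    exact iR'.congr_fun (fun h hh => (fR hh).symm) measurableSet_Ioi
  have iL : IntegrableOn f (Iio (x - ε)) := by
    rw [← mL.integrableOn_comp_preimage eL, pL]
    exact iL'.congr_fun (fun h hh => (fL hh).symm) measurableSet_Ioi
  unfold fracTrunc
  rw [hset, setIntegral_congr_set hae, setIntegral_union hdisj measurableSet_Ioi iL iR,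
    ← mR.setIntegral_preimage_emb eR f (Ioi (x + ε)), ← mL.setIntegral_preimage_emb eL f (Iio (x - ε)), pR, pL,
    setIntegral_congr_fun measurableSet_Ioi fR, setIntegral_congr_fun measurableSet_Ioi fL,
    ← integral_add iL' iR']
  refine setIntegral_congr_fun measurableSet_Ioi fun h _ => ?_
  ring

lemma uaj_measurable (α : ℝ) (j : ℕ) : Measurable (uaj α j) := by
  unfold uaj
  refine Measurable.ite (measurableSet_Ioo (a := (0:ℝ)) (b := 1)) (by fun_prop) ?_
  refine Measurable.ite ?_ measurable_const measurable_const
  by_cases h : j = 0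
  · simp only [h, true_and]; exact measurableSet_Ici
  · simp [h]

lemma uaj_eq_vfun (α : ℝ) (hα : 0 < α) (j : ℕ) (x : ℝ) (h0 : 0 ≤ x) (h1 : x ≤ 1) : uaj α j x = vfun α j x := by
  rcases eq_or_lt_of_le h0 with h | h
  · rw [← h, vfun_zero α hα]; simp [uaj]
  rcases eq_or_lt_of_le h1 with h' | h'
  · rw [h']; by_cases hj : j = 0 <;> simp [uaj, vfun, hj]
  · simp [uaj, vfun, h, h']

lemma uaj_neg (α : ℝ) (j : ℕ) (x : ℝ) (h0 : x ≤ 0) : uaj α j x = 0 := by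
  have h1 : ¬ (0 < x) := by linarith
  have h2 : ¬ (1 ≤ x) := by linarith
  simp [uaj, h1, h2]

lemma uaj_ge (α : ℝ) (j : ℕ) (x : ℝ) (h0 : 1 ≤ x) : uaj α j x = if j = 0 then 1 else 0 := by
  have h1 : ¬ (x < 1) := by linarith
  simp [uaj, h0, h1]

lemma uaj_bdd (α : ℝ) (hα : 0 < α) (j : ℕ) : ∃ B : ℝ, ∀ y, |uaj α j y| ≤ B := by
  obtain ⟨B, hB0, hB⟩ := vfun_bdd α hα j
  refine ⟨max B 1, fun y => ?_⟩
  rcases le_or_gt y 0 with h | h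
  · rw [uaj_neg α j y h, abs_zero]; exact le_max_of_le_left hB0
  rcases le_or_gt y 1 with h' | h'
  · rw [uaj_eq_vfun α hα j y h.le h']; exact le_max_of_le_left (hB y ⟨h.le, by linarith⟩)
  · rw [uaj_ge α j y h'.le]
    apply le_max_of_le_right
    split_ifs <;> simp

lemma tail_part (s α : ℝ) (hs : s ∈ Ioo (0 : ℝ) 1) (hα : 0 < α) (j : ℕ) (x : ℝ) (hx : x ∈ Ioo (0 : ℝ) (1 / 2)) :
    ∫ h in Ioi x, (2 * uaj α j x - uaj α j (x + h) - uaj α j (x - h)) * h ^ (-(1 + 2 * s)) =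
      x ^ (α - 2 * s) * (Real.log x ^ j / s) -
      (∫ h in x..(1 - x), vfun α j (x + h) * h ^ (-(1 + 2 * s))) -
      (if j = 0 then 1 else 0) * (1 - x) ^ (-(2 * s)) * (2 * s)⁻¹ := by
  obtain ⟨hx0, hx1⟩ := hx
  have hs0 := hs.1
  have hlt : -(1 + 2 * s) < -1 := by linarith
  have hc0 : 0 < 1 - x := by linarith
  have hle : x ≤ 1 - x := by linarith
  set c : ℝ := if j = 0 then 1 else 0 with hc
  have hpow : IntegrableOn (fun h : ℝ => h ^ (-(1 + 2 * s))) (Ioi x) := integrableOn_Ioi_rpow_of_lt hlt hx0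
  have hsplit : Ioi x = Ioc x (1 - x) ∪ Ioi (1 - x) := (Ioc_union_Ioi_eq_Ioi hle).symm
  have hdisj : Disjoint (Ioc x (1 - x)) (Ioi (1 - x)) := Ioc_disjoint_Ioi le_rfl
  have hval : ∀ a : ℝ, 0 < a → ∫ h in Ioi a, h ^ (-(1 + 2 * s)) = a ^ (-(2 * s)) * (2 * s)⁻¹ := by
    intro a ha
    rw [integral_Ioi_rpow_of_lt hlt ha, show -(1 + 2 * s) + 1 = -(2 * s) by ring, neg_div_neg_eq, div_eq_mul_inv]
  have hp1 := hpow.mono_set (Ioc_subset_Ioi_self : Ioc x (1 - x) ⊆ Ioi x)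
  have hp2 := hpow.mono_set (Ioi_subset_Ioi hle)
  have hvc : IntegrableOn (fun h => vfun α j (x + h) * h ^ (-(1 + 2 * s))) (Ioc x (1 - x)) := by
    refine (ContinuousOn.integrableOn_Icc ?_).mono_set Ioc_subset_Icc_self
    intro h hh
    have h0 : 0 < h := by linarith [hh.1]
    have h1 : x + h ≠ 0 := by linarith
    unfold vfun
    refine ContinuousAt.continuousWithinAt ?_
    refine ContinuousAt.mul (ContinuousAt.mul ?_ ?_) (Real.continuousAt_rpow_const _ _ (Or.inl h0.ne'))
    · exact ContinuousAt.rpow_const (by fun_prop) (Or.inl h1)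
    · exact (ContinuousAt.log (by fun_prop) h1).pow j
  have e1 : EqOn (fun h => (2 * uaj α j x - uaj α j (x + h) - uaj α j (x - h)) * h ^ (-(1 + 2 * s)))
      (fun h => 2 * vfun α j x * h ^ (-(1 + 2 * s)) - vfun α j (x + h) * h ^ (-(1 + 2 * s))) (Ioc x (1 - x)) := by
    intro h hh
    simp only
    rw [uaj_eq_vfun α hα j x hx0.le (by linarith), uaj_eq_vfun α hα j (x + h) (by linarith [hh.1]) (by linarith [hh.2]),
      uaj_neg α j (x - h) (by linarith [hh.1])]
    ring
  have e2 : EqOn (fun h => (2 * uaj α j x - uaj α j (x + h) - uaj α j (x - h)) * h ^ (-(1 + 2 * s)))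
      (fun h => (2 * vfun α j x - c) * h ^ (-(1 + 2 * s))) (Ioi (1 - x)) := by
    intro h hh
    have hh := mem_Ioi.mp hh
    simp only
    rw [uaj_eq_vfun α hα j x hx0.le (by linarith), uaj_ge α j (x + h) (by linarith), uaj_neg α j (x - h) (by linarith)]
    ring
  have i1 : IntegrableOn (fun h => 2 * vfun α j x * h ^ (-(1 + 2 * s)) - vfun α j (x + h) * h ^ (-(1 + 2 * s))) (Ioc x (1 - x)) :=
    (hp1.const_mul _).sub hvc
  have i2 : IntegrableOn (fun h => (2 * vfun α j x - c) * h ^ (-(1 + 2 * s))) (Ioi (1 - x)) := hp2.const_mul _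
  have hI : ∫ h in Ioc x (1 - x), h ^ (-(1 + 2 * s)) = x ^ (-(2 * s)) * (2 * s)⁻¹ - (1 - x) ^ (-(2 * s)) * (2 * s)⁻¹ := by
    have h1 := hval x hx0
    rw [hsplit, setIntegral_union hdisj measurableSet_Ioi hp1 hp2, hval _ hc0] at h1
    linarith
  rw [hsplit, setIntegral_union hdisj measurableSet_Ioi
    (i1.congr_fun e1.symm measurableSet_Ioc) (i2.congr_fun e2.symm measurableSet_Ioi),
    setIntegral_congr_fun measurableSet_Ioc e1, setIntegral_congr_fun measurableSet_Ioi e2,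
    integral_sub (hp1.const_mul _) hvc, integral_const_mul, integral_const_mul, hI, hval _ hc0,
    intervalIntegral.integral_of_le hle, vfun, sub_eq_add_neg α, Real.rpow_add hx0]
  field_simp
  ring

lemma trunc_limit (s α : ℝ) (hs : s ∈ Ioo (0 : ℝ) 1) (hα : 0 < α) (j : ℕ) (x : ℝ) (hx : x ∈ Ioo (0 : ℝ) (1 / 2))
    (m T : ℝ)
    (hmi : IntervalIntegrable (fun h => (2 * vfun α j x - vfun α j (x + h) - vfun α j (x - h)) *
        h ^ (-(1 + 2 * s))) volume 0 x)
    (hm : ∫ h in (0:ℝ)..x, (2 * vfun α j x - vfun α j (x + h) - vfun α j (x - h)) *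
        h ^ (-(1 + 2 * s)) = m)
    (hT : ∫ h in Ioi x, (2 * uaj α j x - uaj α j (x + h) - uaj α j (x - h)) * h ^ (-(1 + 2 * s)) = T) :
    Tendsto (fracTrunc s (uaj α j) x) (𝓝[>] (0 : ℝ)) (𝓝 (m + T)) := by
  obtain ⟨hx0, hx1⟩ := hx
  obtain ⟨B, hB⟩ := uaj_bdd α hα j
  have hu := uaj_measurable α j
  set f : ℝ → ℝ := fun h => (2 * vfun α j x - vfun α j (x + h) - vfun α j (x - h)) * h ^ (-(1 + 2 * s)) with hf
  have hlim : Tendsto (fun ε => ∫ h in ε..x, f h) (𝓝[>] (0 : ℝ)) (𝓝 m) := by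
    have hc : ContinuousOn (fun ε => ∫ h in x..ε, f h) (uIcc 0 x) :=
      intervalIntegral.continuousOn_primitive_interval' hmi right_mem_uIcc
    have h0 := (hc 0 left_mem_uIcc).tendsto
    rw [uIcc_of_le hx0.le] at h0
    have h1 : 𝓝[>] (0:ℝ) ≤ 𝓝[Icc 0 x] 0 := by
      rw [← nhdsWithin_Ioo_eq_nhdsGT hx0]
      exact nhdsWithin_mono _ Ioo_subset_Icc_self
    have h2 := (h0.mono_left h1).neg
    rw [← intervalIntegral.integral_symm, hm] at h2
    refine h2.congr fun ε => ?_
    rw [← intervalIntegral.integral_symm]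
  refine (hlim.add_const T).congr' ?_
  filter_upwards [Ioo_mem_nhdsGT hx0] with ε hε
  rw [fracTrunc_eq_s19 s hs.1 _ hu B hB x ε hε.1]
  have hD := D_integrable s hs.1 (fun h => 2 * uaj α j x - uaj α j (x + h) - uaj α j (x - h)) (by fun_prop) (4 * B)
    (fun h => by
      have h1 := abs_le.mp (hB x)
      have h2 := abs_le.mp (hB (x + h))
      have h3 := abs_le.mp (hB (x - h))
      rw [abs_le]; constructor <;> linarith [h1.1, h1.2, h2.1, h2.2, h3.1, h3.2]) ε hε.1
  rw [← Ioc_union_Ioi_eq_Ioi hε.2.le] at hD ⊢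
  rw [setIntegral_union (Ioc_disjoint_Ioi le_rfl) measurableSet_Ioi (hD.mono_set subset_union_left) (hD.mono_set subset_union_right), hT,
    intervalIntegral.integral_of_le hε.2.le]
  congr 1
  refine setIntegral_congr_fun measurableSet_Ioc fun h hh => ?_
  have hh0 : 0 < h := hε.1.trans hh.1
  simp only [hf]
  rw [uaj_eq_vfun α hα j x hx0.le (by linarith), uaj_eq_vfun α hα j (x + h) (by linarith) (by linarith [hh.2]),
      uaj_eq_vfun α hα j (x - h) (by linarith [hh.2]) (by linarith)]

lemma fracConst_ne_zero (s : ℝ) (hs : s ∈ Ioo (0 : ℝ) 1) : fracConst s ≠ 0 := by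
  obtain ⟨h0, h1⟩ := hs
  have g1 : 0 < Real.Gamma ((1 + 2 * s) / 2) := Real.Gamma_pos_of_pos (by linarith)
  have g2 : 0 < Real.Gamma (2 - s) := Real.Gamma_pos_of_pos (by linarith)
  have h2 : 0 < 1 - s := by linarith
  have := Real.pi_pos
  unfold fracConst
  positivity

lemma J_all (s α : ℝ) (hs : s ∈ Ioo (0 : ℝ) 1) (j : ℕ) : ∃ Q : Polynomial ℝ, ∃ F : ℝ → ℝ,
    ContDiffOn ℝ (⊤ : ℕ∞) F (Icc (0 : ℝ) (1 / 2)) ∧ Q.natDegree ≤ j + 1 ∧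
    ((¬ ∃ m : ℕ, α - 2 * s = m) → Q.natDegree ≤ j) ∧
    (∀ x ∈ Ioo (0 : ℝ) (1 / 2), ∫ h in x..(1 - x), vfun α j (x + h) * h ^ (-(1 + 2 * s)) =
      F x - x ^ (α - 2 * s) * Q.eval (Real.log x)) ∧
    (α = 1 → j = 0 → s ≠ 1 / 2 → Q.coeff 0 = 1 / (1 - 2 * s) - 1 / (2 * s)) ∧
    (α = 1 → j = 0 → s = 1 / 2 → Q.coeff 1 = 1) := by
  by_cases h : α = 1 ∧ j = 0
  · obtain ⟨rfl, rfl⟩ := h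
    obtain ⟨Q, F, h1, h2, h3, h4, h5, h6⟩ := J_special s hs
    exact ⟨Q, F, h1, h2, h3, h4, fun _ _ => h5, fun _ _ => h6⟩
  · obtain ⟨Q, F, h1, h2, h3, h4⟩ := J_general s α j
    exact ⟨Q, F, h1, h2, h3, h4, fun a b => absurd ⟨a, b⟩ h, fun a b => absurd ⟨a, b⟩ h⟩

lemma poly_form (s α : ℝ) (hs : s ∈ Ioo (0 : ℝ) 1) (hα : 0 < α) (j : ℕ) :
    ∃ R : Polynomial ℝ, ∃ F : ℝ → ℝ,
    ContDiffOn ℝ (⊤ : ℕ∞) F (Icc (0 : ℝ) (1 / 2)) ∧ R.natDegree ≤ j + 1 ∧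
    ((¬ ∃ m : ℕ, α - 2 * s = m) → R.natDegree ≤ j) ∧
    (∀ x ∈ Ioo (0 : ℝ) (1 / 2), HasFracLap s (uaj α j) x
      (x ^ (α - 2 * s) * R.eval (Real.log x) + F x)) ∧
    (α = 1 → j = 0 → s ≠ 1 / 2 → R.coeff 0 ≠ 0) ∧
    (α = 1 → j = 0 → s = 1 / 2 → R.coeff 1 ≠ 0) := by
  obtain ⟨Q, F, hF, hQ1, hQ2, hJ, hQ3, hQ4⟩ := J_all s α hs j
  obtain ⟨p, hp1, hp2, hp3⟩ := mid_part s α hs hα j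
  have hK := fracConst_ne_zero s hs
  have hs0 := hs.1
  set K := fracConst s with hKdef
  have hdeg : ∀ N, j ≤ N → Q.natDegree ≤ N →
      (Polynomial.C K * (p + Polynomial.C s⁻¹ * Polynomial.X ^ j + Q)).natDegree ≤ N := by
    intro N hN hQN
    refine (Polynomial.natDegree_C_mul_le _ _).trans ((Polynomial.natDegree_add_le _ _).trans (max_le ?_ hQN))
    exact (Polynomial.natDegree_add_le _ _).trans
      (max_le (hp1.trans hN) ((Polynomial.natDegree_C_mul_X_pow_le _ _).trans hN))
  have hne : ∀ x ∈ Icc (0 : ℝ) (1 / 2), 1 - x ≠ 0 := by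
    intro x hx; have := hx.2; intro h; linarith
  have hsm : ContDiffOn ℝ (⊤ : ℕ∞) (fun x : ℝ => 1 - x) (Icc (0 : ℝ) (1 / 2)) := by fun_prop
  refine ⟨Polynomial.C K * (p + Polynomial.C s⁻¹ * Polynomial.X ^ j + Q),
    fun x => -K * (F x + (if j = 0 then 1 else 0) * (1 - x) ^ (-(2 * s)) * (2 * s)⁻¹), ?_,
    hdeg _ (Nat.le_succ j) hQ1, fun h => hdeg _ le_rfl (hQ2 h), ?_, ?_, ?_⟩
  · exact contDiffOn_const.mul (hF.add ((contDiffOn_const.mul (hsm.rpow_const_of_ne hne)).mul contDiffOn_const))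
  · intro x hx
    obtain ⟨hmi, hm⟩ := hp3 x hx.1
    refine ⟨_, trunc_limit s α hs hα j x hx _ _ hmi hm (tail_part s α hs hα j x hx), ?_⟩
    rw [hJ x hx]
    simp only [Polynomial.eval_mul, Polynomial.eval_add, Polynomial.eval_C, Polynomial.eval_pow, Polynomial.eval_X]
    rw [← hKdef]
    ring
  · intro h1 h2 h3
    have h12 : 1 - 2 * s ≠ 0 := by intro h'; apply h3; linarith
    rw [Polynomial.coeff_C_mul, Polynomial.coeff_add, Polynomial.coeff_add, hp2 h1 h2, hQ3 h1 h2 h3, h2]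
    refine mul_ne_zero hK ?_
    have : (0 : Polynomial ℝ).coeff 0 + (Polynomial.C s⁻¹ * Polynomial.X ^ 0).coeff 0 + (1 / (1 - 2 * s) - 1 / (2 * s)) = 1 / (2 * s * (1 - 2 * s)) := by
      rw [pow_zero, mul_one, Polynomial.coeff_C_zero, Polynomial.coeff_zero]
      obtain ⟨c, hc⟩ : ∃ c, c = 1 - 2 * s := ⟨_, rfl⟩
      rw [← hc] at h12 ⊢
      field_simp
      rw [hc]
      ring
    rw [this]
    exact one_div_ne_zero (mul_ne_zero (by linarith) h12)
  · intro h1 h2 h3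
    rw [Polynomial.coeff_C_mul, Polynomial.coeff_add, Polynomial.coeff_add, hp2 h1 h2, hQ4 h1 h2 h3, h2]
    refine mul_ne_zero hK ?_
    rw [pow_zero, mul_one, Polynomial.coeff_C_succ, Polynomial.coeff_zero]
    norm_num


/-- Expansion of `(-Δ)^s u_{α,j}` on `(0, 1/2)`:
`(-Δ)^s u_{α,j}(x) = x^{α-2s} ∑_{i=0}^{j+1} a_i log^i x + F(x)` with `F` smooth on
`[0,1/2]`; moreover `a_{j+1} = 0` if `α - 2s ∉ ℕ ∪ {0}`, `a_0 = 0` if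
`α - 2s ∈ ℕ ∪ {0}`, and for `α = 1`, `j = 0` the relevant coefficient does not vanish. -/
theorem fracLap_of_building_blocks
    (s α : ℝ) (hs : s ∈ Ioo (0 : ℝ) 1) (hα : 0 < α) (j : ℕ) :
    ∃ a : ℕ → ℝ, ∃ F : ℝ → ℝ,
      ContDiffOn ℝ (⊤ : ℕ∞) F (Icc (0 : ℝ) (1 / 2)) ∧
      (∀ x ∈ Ioo (0 : ℝ) (1 / 2),
        HasFracLap s (uaj α j) x
          (x ^ (α - 2 * s) * ∑ i ∈ Finset.range (j + 2), a i * Real.log x ^ i + F x)) ∧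
      ((¬ ∃ m : ℕ, α - 2 * s = (m : ℝ)) → a (j + 1) = 0) ∧
      ((∃ m : ℕ, α - 2 * s = (m : ℝ)) → a 0 = 0) ∧
      (α = 1 → j = 0 → s ≠ 1 / 2 → a 0 ≠ 0) ∧
      (α = 1 → j = 0 → s = 1 / 2 → a 1 ≠ 0) := by
  obtain ⟨R, F, hF, hR1, hR2, hL, hR3, hR4⟩ := poly_form s α hs hα j
  have hev : ∀ z : ℝ, R.eval z = ∑ i ∈ Finset.range (j + 2), R.coeff i * z ^ i := fun z =>
    Polynomial.eval_eq_sum_range' (lt_of_le_of_lt hR1 (Nat.lt_succ_self _)) z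
  by_cases hm : ∃ m : ℕ, α - 2 * s = (m : ℝ)
  · obtain ⟨m, hm'⟩ := hm
    refine ⟨fun i => if i = 0 then 0 else R.coeff i, fun x => F x + R.coeff 0 * x ^ m, ?_, ?_,
      fun h => absurd ⟨m, hm'⟩ h, fun _ => by simp, ?_, ?_⟩
    · exact hF.add (by fun_prop)
    · intro x hx
      have h := hL x hx
      convert h using 1
      rw [hev, hm', Real.rpow_natCast, Finset.sum_range_succ', Finset.sum_range_succ' (fun i => R.coeff i * Real.log x ^ i)]
      simp
      ring
    · intro h1 h2 h3
      exfalso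
      have hs1 := hs.1
      have hs2 := hs.2
      rw [h1] at hm'
      have h4 : (m : ℝ) < 1 := by linarith
      have h5 : m = 0 := by
        have : m < 1 := by exact_mod_cast h4
        omega
      rw [h5] at hm'
      apply h3
      push_cast at hm'
      linarith
    · intro h1 h2 h3
      simpa using hR4 h1 h2 h3
  · refine ⟨R.coeff, F, hF, ?_, fun _ => ?_, fun h => absurd h hm, hR3, hR4⟩
    · intro x hx
      rw [← hev]
      exact hL x hx
    · exact Polynomial.coeff_eq_zero_of_natDegree_lt (lt_of_le_of_lt (hR2 hm) (Nat.lt_succ_self j))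
end
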